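/- Pick's theorem: for a simple polygon with vertices in ℤ², its area equals I + B/2 − 1, where I is the number of lattice points strictly inside the polygon and B is the number of lattice points on its boundary. -/

import Mathlib

open MeasureTheory

/-- The determinant of two plane vectors. -/
def planeDet (u w : ℝ × ℝ) : ℝ := u.1 * w.2 - u.2 * w.1

/-- The signed number of times the straight path from `u` to `w` crosses the vertical axis,
counted positively when turning counterclockwise around the origin. -/
noncomputable def halfTurn (u w : ℝ × ℝ) : ℝ :=
  if u.1 * w.1 < 0 then Real.sign (planeDet u w) else 0

lemma halfTurn_neg_neg (u w : ℝ × ℝ) : halfTurn (-u) (-w) = halfTurn u w := by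
  simp [halfTurn, planeDet]

lemma halfTurn_of_mul_pos {u w : ℝ × ℝ} (h : 0 < u.1 * w.1) : halfTurn u w = 0 := by
  simp [halfTurn, h.not_gt]

lemma halfTurn_swap (u w : ℝ × ℝ) : halfTurn w u = -halfTurn u w := by
  unfold halfTurn planeDet
  rw [mul_comm w.1 u.1]
  split_ifs
  · rw [← Real.sign_neg]
    congr 1
    ring
  · simp

/-- Two parallel vectors on different sides of the vertical axis are antiparallel. -/
lemma abs_combination_eq_zero {z w : ℝ × ℝ} (h : z.1 * w.1 < 0) (hd : planeDet z w = 0) :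
    |w.1| * z.1 + |z.1| * w.1 = 0 ∧ |w.1| * z.2 + |z.1| * w.2 = 0 := by
  unfold planeDet at hd
  rcases mul_neg_iff.1 h with ⟨h1, h2⟩ | ⟨h1, h2⟩
  · rw [abs_of_pos h1, abs_of_neg h2]
    constructor <;> linarith
  · rw [abs_of_neg h1, abs_of_pos h2]
    constructor <;> linarith

/-- A triangle missing the origin whose last vertex is separated from the other two by the
vertical axis. -/
lemma halfTurn_eq_of_mul_neg {u v w : ℝ × ℝ} (huw : u.1 * w.1 < 0) (hvw : v.1 * w.1 < 0)
    (h : ∀ a b c : ℝ, 0 ≤ a → 0 ≤ b → 0 ≤ c → a * u.1 + b * v.1 + c * w.1 = 0 →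
      a * u.2 + b * v.2 + c * w.2 = 0 → a = 0 ∧ b = 0 ∧ c = 0) :
    halfTurn u w = halfTurn v w := by
  have hw : 0 < |w.1| := abs_pos.2 (by rintro h0; simp [h0] at huw)
  have key : ∀ a b : ℝ, 0 ≤ a → 0 ≤ b → 0 < a + b →
      a * planeDet u w + b * planeDet v w ≠ 0 := by
    intro a b ha hb hab h0
    have hz : (a • u + b • v).1 * w.1 < 0 := by
      simp only [Prod.fst_add, Prod.smul_fst, smul_eq_mul]
      rcases ha.eq_or_lt with rfl | ha'
      · nlinarith [mul_neg_of_pos_of_neg (show 0 < b by linarith) hvw]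
      · nlinarith [mul_neg_of_pos_of_neg ha' huw, mul_nonneg hb (neg_nonneg.2 hvw.le)]
    have hd : planeDet (a • u + b • v) w = 0 := by
      rw [← h0]
      simp only [planeDet, Prod.fst_add, Prod.smul_fst, Prod.snd_add, Prod.smul_snd, smul_eq_mul]
      ring
    obtain ⟨h1, h2⟩ := abs_combination_eq_zero hz hd
    simp only [Prod.fst_add, Prod.smul_fst, Prod.snd_add, Prod.smul_snd, smul_eq_mul] at h1 h2
    obtain ⟨h3, h4, -⟩ := h (|w.1| * a) (|w.1| * b) _ (by positivity) (by positivity)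
      (abs_nonneg _) (by linarith) (by linarith)
    have h5 : |w.1| * (a + b) = 0 := by linarith
    exact (mul_pos hw hab).ne' h5
  unfold halfTurn
  rw [if_pos huw, if_pos hvw]
  have hu0 := key 1 0 (by norm_num) (by norm_num) (by norm_num)
  have hv0 := key 0 1 (by norm_num) (by norm_num) (by norm_num)
  simp only [one_mul, zero_mul, add_zero, zero_add] at hu0 hv0
  rcases lt_or_gt_of_ne hu0 with hu | hu <;> rcases lt_or_gt_of_ne hv0 with hv | hv
  · rw [Real.sign_of_neg hu, Real.sign_of_neg hv]
  · exact (key (planeDet v w) (-planeDet u w) hv.le (by linarith) (by linarith) (by ring)).elim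
  · exact (key (-planeDet v w) (planeDet u w) (by linarith) hu.le (by linarith) (by ring)).elim
  · rw [Real.sign_of_pos hu, Real.sign_of_pos hv]

/-- The crossing number is additive along the sides of a triangle missing the origin. -/
lemma halfTurn_add {u v w : ℝ × ℝ} (hu : u.1 ≠ 0) (hv : v.1 ≠ 0) (hw : w.1 ≠ 0)
    (h : ∀ a b c : ℝ, 0 ≤ a → 0 ≤ b → 0 ≤ c → a * u.1 + b * v.1 + c * w.1 = 0 →
      a * u.2 + b * v.2 + c * w.2 = 0 → a = 0 ∧ b = 0 ∧ c = 0) :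
    halfTurn u v + halfTurn v w = halfTurn u w := by
  rcases lt_or_gt_of_ne (mul_ne_zero hu hv) with h1 | h1 <;>
  rcases lt_or_gt_of_ne (mul_ne_zero hv hw) with h2 | h2
  · have h3 : 0 < u.1 * w.1 := by
      by_contra hcon
      nlinarith [mul_pos_of_neg_of_neg h1 h2, mul_self_pos.2 hv]
    have h4 := halfTurn_eq_of_mul_neg h1 (mul_comm v.1 w.1 ▸ h2)
      (fun a b c ha hb hc e1 e2 ↦ by
        obtain ⟨r1, r2, r3⟩ := h a c b ha hc hb (by linarith) (by linarith)
        exact ⟨r1, r3, r2⟩)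
    rw [halfTurn_of_mul_pos h3, h4, halfTurn_swap v w]
    ring
  · have h3 : u.1 * w.1 < 0 := by
      by_contra hcon
      nlinarith [mul_neg_of_neg_of_pos h1 h2, mul_self_pos.2 hv]
    have h4 := halfTurn_eq_of_mul_neg (mul_comm u.1 v.1 ▸ h1) (mul_comm u.1 w.1 ▸ h3)
      (fun a b c ha hb hc e1 e2 ↦ by
        obtain ⟨r1, r2, r3⟩ := h c a b hc ha hb (by linarith) (by linarith)
        exact ⟨r2, r3, r1⟩)
    rw [halfTurn_of_mul_pos h2, halfTurn_swap v u, h4, halfTurn_swap u w]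
    ring
  · have h3 : u.1 * w.1 < 0 := by
      by_contra hcon
      nlinarith [mul_neg_of_pos_of_neg h1 h2, mul_self_pos.2 hv]
    rw [halfTurn_of_mul_pos h1, halfTurn_eq_of_mul_neg h3 h2 h, zero_add]
  · have h3 : 0 < u.1 * w.1 := by
      by_contra hcon
      nlinarith [mul_pos h1 h2, mul_self_pos.2 hv]
    rw [halfTurn_of_mul_pos h1, halfTurn_of_mul_pos h2, halfTurn_of_mul_pos h3, zero_add]

/-- A simple closed polygon, given by its `n`-periodic sequence of vertices, no two of which lie
on the same vertical line. -/
structure GenericPolygon (n : ℕ) where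
  vert : ℕ → ℝ × ℝ
  three_le : 3 ≤ n
  periodic : ∀ i, vert (i + n) = vert i
  fst_ne : ∀ i j, i < j → j < i + n → (vert i).1 ≠ (vert j).1
  adjacent : ∀ i z, z ∈ segment ℝ (vert i) (vert (i + 1)) →
    z ∈ segment ℝ (vert (i + 1)) (vert (i + 2)) → z = vert (i + 1)
  disjoint : ∀ i j, i + 1 < j → j + 1 < i + n → ∀ z,
    z ∈ segment ℝ (vert i) (vert (i + 1)) → z ∉ segment ℝ (vert j) (vert (j + 1))

namespace GenericPolygon

variable {n : ℕ} (P : GenericPolygon n)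

/-- The closed edge from vertex `i` to vertex `i + 1`. -/
def edge (i : ℕ) : Set (ℝ × ℝ) := segment ℝ (P.vert i) (P.vert (i + 1))

/-- The vector from vertex `i` to vertex `j`. -/
def secant (i j : ℕ) : ℝ × ℝ := P.vert j - P.vert i

/-- The direction vector of edge `i`. -/
def dir (i : ℕ) : ℝ × ℝ := P.secant i (i + 1)

/-- The point of the line through edge `i` with affine parameter `t`. -/
def point (i : ℕ) (t : ℝ) : ℝ × ℝ := P.vert i + t • P.dir i

/-- The crossing number of the direction vector at the vertex `i + 1`. -/
noncomputable def turnAt (i : ℕ) : ℝ := halfTurn (P.dir i) (P.dir (i + 1))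

lemma mem_edge {i : ℕ} {z : ℝ × ℝ} : z ∈ P.edge i ↔ ∃ t, 0 ≤ t ∧ t ≤ 1 ∧ P.point i t = z := by
  unfold edge point dir secant
  rw [segment_eq_image']
  simp only [Set.mem_image, Set.mem_Icc, and_assoc]

lemma point_one (i : ℕ) : P.point i 1 = P.vert (i + 1) := by
  simp [point, dir, secant]

lemma secant_add (i j k : ℕ) : P.secant i j + P.secant j k = P.secant i k := by
  simp [secant]

lemma secant_fst_ne {i j : ℕ} (h : i < j) (h' : j < i + n) : (P.secant i j).1 ≠ 0 := by
  simpa [secant, sub_eq_zero] using (P.fst_ne i j h h').symm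

lemma dir_fst_ne (i : ℕ) : (P.dir i).1 ≠ 0 :=
  P.secant_fst_ne (Nat.lt_succ_self i) (by have := P.three_le; omega)

/-- Consecutive edges do not fold back onto each other. -/
lemma dir_combination_eq_zero {i : ℕ} {a b : ℝ} (ha : 0 ≤ a) (hb : 0 ≤ b)
    (h : a • P.dir i + b • P.dir (i + 1) = 0) : a = 0 ∧ b = 0 := by
  by_contra hne
  have hab : 0 < a + b := by
    by_contra hcon
    exact hne ⟨by linarith, by linarith⟩
  have hp : P.point (i + 1) (b / (a + b)) = P.point i (1 - a / (a + b)) := by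
    have e : (a / (a + b)) • P.dir i + (b / (a + b)) • P.dir (i + 1) = 0 := by
      rw [div_eq_inv_mul, div_eq_inv_mul, mul_smul, mul_smul, ← smul_add, h, smul_zero]
    have e1 := P.point_one i
    unfold point at e1 ⊢
    rw [sub_smul, ← add_sub_assoc, e1, eq_sub_iff_add_eq, add_assoc, add_comm (_ • _), e, add_zero]
  have ha1 : a / (a + b) ≤ 1 := (div_le_one hab).2 (by linarith)
  have hb1 : b / (a + b) ≤ 1 := (div_le_one hab).2 (by linarith)
  have hz : P.point (i + 1) (b / (a + b)) = P.vert (i + 1) := by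
    refine P.adjacent i _ (P.mem_edge.2 ⟨1 - a / (a + b), by linarith, ?_, hp.symm⟩)
      (P.mem_edge.2 ⟨b / (a + b), by positivity, hb1, rfl⟩)
    have : 0 ≤ a / (a + b) := by positivity
    linarith
  have hb0 : b = 0 := by
    have h1 : b / (a + b) * (P.dir (i + 1)).1 = 0 := by
      simpa [point] using congrArg Prod.fst hz
    rcases mul_eq_zero.1 h1 with h2 | h2
    · exact (div_eq_zero_iff.1 h2).resolve_right hab.ne'
    · exact (P.dir_fst_ne _ h2).elim
  subst hb0
  have h1 : a * (P.dir i).1 = 0 := by simpa using congrArg Prod.fst h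
  exact hne ⟨(mul_eq_zero.1 h1).resolve_right (P.dir_fst_ne i), rfl⟩

lemma halfTurn_dir (i : ℕ) (k : ℝ × ℝ) (hk : k = P.dir i + P.dir (i + 1)) (hk1 : k.1 ≠ 0) :
    halfTurn (P.dir i) k + halfTurn k (P.dir (i + 1)) = P.turnAt i := by
  refine halfTurn_add (P.dir_fst_ne i) hk1 (P.dir_fst_ne _) ?_
  intro a b c ha hb hc h1 h2
  obtain ⟨r1, r2⟩ := P.dir_combination_eq_zero (i := i) (add_nonneg ha hb) (add_nonneg hb hc) (by
    subst hk
    ext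
    · simp only [Prod.fst_add, Prod.smul_fst, smul_eq_mul, Prod.fst_zero] at h1 ⊢
      linarith
    · simp only [Prod.snd_add, Prod.smul_snd, smul_eq_mul, Prod.snd_zero] at h2 ⊢
      linarith)
  exact ⟨by linarith, by linarith, by linarith⟩

/-- Combinations witnessing a common point of two disjoint edges are trivial. -/
lemma combination_eq_zero {i j : ℕ} (hij : i + 1 < j) (hji : j + 1 < i + n) {a b c d : ℝ}
    (ha : 0 ≤ a) (hb : 0 ≤ b) (hc : 0 ≤ c) (hd : 0 ≤ d) (hs : a + b = c + d)
    (h : a • P.vert i + b • P.vert (i + 1) = c • P.vert j + d • P.vert (j + 1)) :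
    a + b = 0 := by
  by_contra hne
  have hab : 0 < a + b := lt_of_le_of_ne (add_nonneg ha hb) (Ne.symm hne)
  refine P.disjoint i j hij hji ((a + b)⁻¹ • (a • P.vert i + b • P.vert (i + 1))) ?_ ?_
  · refine ⟨(a + b)⁻¹ * a, (a + b)⁻¹ * b, by positivity, by positivity, by field_simp, ?_⟩
    rw [smul_add, mul_smul, mul_smul]
  · rw [h]
    refine ⟨(a + b)⁻¹ * c, (a + b)⁻¹ * d, by positivity, by positivity, ?_, ?_⟩
    · rw [← mul_add, ← hs, inv_mul_cancel₀ hne]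
    · rw [smul_add, mul_smul, mul_smul]

/-- The crossing number of the secant vector around the boundary of a pair of disjoint edges
vanishes. -/
lemma halfTurn_secant_square {i j : ℕ} (hij : i + 1 < j) (hji : j + 1 < i + n) :
    halfTurn (P.secant i j) (P.secant i (j + 1)) +
      halfTurn (P.secant i (j + 1)) (P.secant (i + 1) (j + 1)) =
    halfTurn (P.secant i j) (P.secant (i + 1) j) +
      halfTurn (P.secant (i + 1) j) (P.secant (i + 1) (j + 1)) := by
  rw [halfTurn_add (P.secant_fst_ne (by omega) (by omega)) (P.secant_fst_ne (by omega) (by omega))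
      (P.secant_fst_ne (by omega) (by omega)),
    halfTurn_add (P.secant_fst_ne (by omega) (by omega)) (P.secant_fst_ne (by omega) (by omega))
      (P.secant_fst_ne (by omega) (by omega))]
  · intro a b c ha hb hc h1 h2
    have h3 := P.combination_eq_zero hij hji (a := a) (b := b + c) (c := a + b) (d := c) ha
      (by positivity) (by positivity) hc (by ring) (by
        ext
        · simp [secant] at h1 ⊢
          linarith
        · simp [secant] at h2 ⊢
          linarith)
    exact ⟨by linarith, by linarith, by linarith⟩
  · intro a b c ha hb hc h1 h2
    have h3 := P.combination_eq_zero hij hji (a := a + b) (b := c) (c := a) (d := b + c)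
      (by positivity) hc ha (by positivity) (by ring) (by
        ext
        · simp [secant] at h1 ⊢
          linarith
        · simp [secant] at h2 ⊢
          linarith)
    exact ⟨by linarith, by linarith, by linarith⟩

lemma halfTurn_secant_strip (k : ℕ) : ∀ a : ℕ, k + 2 < n →
    halfTurn (P.secant a (a + k + 1)) (P.secant a (a + k + 2)) +
      ∑ i ∈ Finset.range (k + 1),
        halfTurn (P.secant (a + i) (a + k + 2)) (P.secant (a + i + 1) (a + k + 2)) =
    ∑ i ∈ Finset.range k,
        halfTurn (P.secant (a + i) (a + k + 1)) (P.secant (a + i + 1) (a + k + 1)) +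
      P.turnAt (a + k) := by
  induction k with
  | zero =>
    intro a hk
    simp only [zero_add, Finset.range_one, Finset.sum_singleton, Finset.range_zero,
      Finset.sum_empty, add_zero]
    exact P.halfTurn_dir a _ (P.secant_add _ _ _).symm (P.secant_fst_ne (by omega) (by omega))
  | succ k ih =>
    intro a hk
    have h1 := ih (a + 1) (by omega)
    have h2 := P.halfTurn_secant_square (i := a) (j := a + k + 2) (by omega) (by omega)
    rw [Finset.sum_range_succ' _ (k + 1),
      Finset.sum_range_succ' (fun i ↦ halfTurn (P.secant (a + i) (a + (k + 1) + 1)) _) k]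
    have e1 : ∀ i, a + 1 + i = a + (i + 1) := fun i ↦ by ring
    have e4 : a + (k + 1) = a + k + 1 := by ring
    simp only [e1, e4, show a + k + 1 + 1 = a + k + 2 from rfl,
      show a + k + 1 + 2 = a + k + 3 from rfl, add_zero] at h1 h2 ⊢
    linarith

/-- **Theorem of turning tangents** for a polygon whose vertex `0` is leftmost. -/
lemma sum_turnAt (hmin : ∀ i, 0 < i → i < n → (P.vert 0).1 < (P.vert i).1) :
    ∑ i ∈ Finset.range n, P.turnAt i = 2 * P.turnAt (n - 1) := by
  obtain ⟨m, rfl⟩ : ∃ m, n = m + 3 := ⟨n - 3, by have := P.three_le; omega⟩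
  have hrow : ∀ i j, 0 < i → i < m + 3 → 0 < j → j < m + 3 →
      halfTurn (P.secant 0 i) (P.secant 0 j) = 0 := fun i j hi hi' hj hj' ↦
    halfTurn_of_mul_pos (mul_pos (by simpa [secant] using hmin i hi hi')
      (by simpa [secant] using hmin j hj hj'))
  have hv : P.vert (m + 3) = P.vert 0 := by simpa using P.periodic 0
  have hcol : ∀ i j, 0 < i → i < m + 3 → 0 < j → j < m + 3 →
      halfTurn (P.secant i (m + 3)) (P.secant j (m + 3)) = 0 := fun i j hi hi' hj hj' ↦
    halfTurn_of_mul_pos (mul_pos_of_neg_of_neg (by simpa [secant, hv] using hmin i hi hi')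
      (by simpa [secant, hv] using hmin j hj hj'))
  have hC : ∀ k, k < m + 2 → ∑ i ∈ Finset.range k,
      halfTurn (P.secant i (k + 1)) (P.secant (i + 1) (k + 1)) =
        ∑ i ∈ Finset.range k, P.turnAt i := by
    intro k
    induction k with
    | zero => simp
    | succ k ih =>
      intro hk
      have h1 := P.halfTurn_secant_strip k 0 (by omega)
      simp only [zero_add] at h1
      rw [hrow _ _ (by omega) (by omega) (by omega) (by omega), zero_add, ih (by omega)] at h1
      rw [Finset.sum_range_succ P.turnAt k, ← h1]
  have h1 := hC (m + 1) (by omega)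
  have h2 := P.halfTurn_secant_strip m 1 (by omega)
  rw [Finset.sum_range_succ'] at h1
  have e1 : ∀ i, 1 + i = i + 1 := fun i ↦ by ring
  have e2 : 1 + m + 1 = m + 2 := by ring
  have e3 : 1 + m + 2 = m + 3 := by ring
  simp only [e1, show m + 1 + 1 = m + 2 from rfl, show m + 1 + 2 = m + 3 from rfl, zero_add]
    at h1 h2
  rw [Finset.sum_eq_zero (s := Finset.range (m + 1)) (fun i hi ↦ by
    have := Finset.mem_range.1 hi
    exact hcol _ _ (by omega) (by omega) (by omega) (by omega)), add_zero] at h2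
  have h3 : halfTurn (P.secant 0 (m + 2)) (P.secant 1 (m + 2)) +
      halfTurn (P.secant 1 (m + 2)) (P.secant 1 (m + 3)) = P.turnAt (m + 2) := by
    have hv' : P.vert (m + 4) = P.vert 1 := by
      rw [← P.periodic 1]
      congr 1
      ring
    have hs : P.secant (m + 2) (m + 3) = -P.secant 0 (m + 2) := by simp [secant, hv]
    have hs' : P.secant (m + 3) (m + 4) = -P.secant 1 (m + 3) := by
      simp [secant, hv']
    have h4 := P.halfTurn_dir (m + 2) (-P.secant 1 (m + 2)) (by
      simp [dir, show m + 2 + 1 = m + 3 from rfl, show m + 3 + 1 = m + 4 from rfl, secant, hv, hv']) (by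
      simpa using P.secant_fst_ne (i := 1) (j := m + 2) (by omega) (by omega))
    simp only [dir, show m + 2 + 1 = m + 3 from rfl, show m + 3 + 1 = m + 4 from rfl, hs, hs',
      halfTurn_neg_neg] at h4
    exact h4
  simp only [show m + 3 - 1 = m + 2 from rfl]
  rw [Finset.sum_range_succ, Finset.sum_range_succ]
  linarith

end GenericPolygon

namespace GenericPolygon

variable {n : ℕ} (P : GenericPolygon n)

/-- The union of all edges. -/
def boundary : Set (ℝ × ℝ) := {z | ∃ i, z ∈ P.edge i}

/-- A signed multiple of the distance to the line through edge `i`, positive on the left. -/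
def side (i : ℕ) (z : ℝ × ℝ) : ℝ := planeDet (P.dir i) (z - P.vert i)

lemma edge_periodic (i : ℕ) : P.edge (i + n) = P.edge i := by
  rw [edge, edge, P.periodic, show i + n + 1 = i + 1 + n by ring, P.periodic]

lemma edge_mod (i : ℕ) : P.edge (i % n) = P.edge i :=
  Function.Periodic.map_mod_nat P.edge_periodic i

lemma n_pos {n : ℕ} (P : GenericPolygon n) : 0 < n := by have := P.three_le; omega

/-- Every edge occurs among any `n` consecutive ones. -/
lemma exists_window (i j : ℕ) : ∃ k, i ≤ k ∧ k < i + n ∧ P.edge j = P.edge k := by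
  have hn := P.n_pos
  refine ⟨(j + i * n - i) % n + i, by omega, ?_, ?_⟩
  · have := Nat.mod_lt (j + i * n - i) hn
    omega
  · rw [← P.edge_mod ((j + i * n - i) % n + i), Nat.mod_add_mod, Nat.sub_add_cancel,
      Nat.add_mul_mod_self_right, P.edge_mod]
    exact (Nat.le_mul_of_pos_right i hn).trans (Nat.le_add_left _ _)

lemma isClosed_edge (i : ℕ) : IsClosed (P.edge i) := by
  unfold edge
  rw [segment_eq_image']
  exact (isCompact_Icc.image (by fun_prop)).isClosed

/-- Near a given point only the edges through this point occur. -/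
lemma eventually_mem_edge (z₀ : ℝ × ℝ) :
    ∀ᶠ z in nhds z₀, ∀ i, z ∈ P.edge i → z₀ ∈ P.edge i := by
  have h : ∀ᶠ z in nhds z₀, ∀ i ∈ Finset.range n, z ∈ P.edge i → z₀ ∈ P.edge i := by
    rw [Filter.eventually_all_finset]
    intro i _
    by_cases hz : z₀ ∈ P.edge i
    · exact Filter.Eventually.of_forall fun _ _ ↦ hz
    · filter_upwards [(P.isClosed_edge i).isOpen_compl.mem_nhds hz] with z h1 h2
      exact (h1 h2).elim
  filter_upwards [h] with z hz i
  rw [← P.edge_mod]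
  exact hz _ (Finset.mem_range.2 (Nat.mod_lt _ P.n_pos))

lemma vert_add_one (i : ℕ) : P.vert (i + 1) = P.vert i + P.dir i := by simp [dir, secant]

lemma planeDet_add_smul (u a v : ℝ × ℝ) (t : ℝ) :
    planeDet u (a + t • v) = planeDet u a + t * planeDet u v := by
  simp only [planeDet, Prod.fst_add, Prod.snd_add, Prod.smul_fst, Prod.smul_snd, smul_eq_mul]
  ring

lemma side_add_smul (i : ℕ) (q v : ℝ × ℝ) (t : ℝ) :
    P.side i (q + t • v) = P.side i q + t * planeDet (P.dir i) v := by
  rw [side, side, ← planeDet_add_smul]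
  congr 1
  abel

lemma planeDet_self (u : ℝ × ℝ) : planeDet u u = 0 := by
  unfold planeDet
  ring

lemma side_vert (i : ℕ) : P.side i (P.vert i) = 0 := by simp [side, planeDet]

lemma side_point (i : ℕ) (t : ℝ) : P.side i (P.point i t) = 0 := by
  rw [point, side_add_smul, side_vert, planeDet_self]
  ring

lemma side_vert_succ (i : ℕ) : P.side i (P.vert (i + 1)) = 0 := by
  rw [← P.point_one, side_point]

lemma side_eq_zero {i : ℕ} {z : ℝ × ℝ} (h : z ∈ P.edge i) : P.side i z = 0 := by
  obtain ⟨t, -, -, rfl⟩ := P.mem_edge.1 h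
  exact P.side_point i t

lemma point_eq (i : ℕ) (t : ℝ) : P.point i t = P.vert (i + 1) + (t - 1) • P.dir i := by
  rw [vert_add_one, point, sub_smul, one_smul]
  abel

/-- Twice the signed area of the triangle at the vertex `i + 1`. -/
def turnDet (i : ℕ) : ℝ := planeDet (P.dir i) (P.dir (i + 1))

lemma planeDet_swap (u w : ℝ × ℝ) : planeDet u w = -planeDet w u := by
  unfold planeDet
  ring

lemma side_succ_point (i : ℕ) (t : ℝ) :
    P.side (i + 1) (P.point i t) = (1 - t) * P.turnDet i := by
  rw [point_eq, side_add_smul, side_vert, turnDet, planeDet_swap]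
  ring

lemma side_point_succ (i : ℕ) (t : ℝ) :
    P.side i (P.point (i + 1) t) = t * P.turnDet i := by
  rw [point, side_add_smul, side_vert_succ, turnDet]
  ring

lemma continuous_side (i : ℕ) : Continuous (P.side i) := by
  unfold side planeDet
  fun_prop

lemma continuous_point (i : ℕ) : Continuous (P.point i) := by
  unfold point
  fun_prop

lemma point_fst (i : ℕ) (t : ℝ) : (P.point i t).1 = (P.vert i).1 + t * (P.dir i).1 := by
  simp [point]

/-- Relative interior points of an edge lie on no other edge. -/
lemma point_notMem_edge {i j : ℕ} (hij : i < j) (hji : j < i + n) {t : ℝ} (h0 : 0 < t)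
    (h1 : t < 1) : P.point i t ∉ P.edge j := by
  intro hj
  have hi : P.point i t ∈ P.edge i := P.mem_edge.2 ⟨t, h0.le, h1.le, rfl⟩
  have hd := P.dir_fst_ne i
  rcases Nat.eq_or_lt_of_le (Nat.succ_le_of_lt hij) with h | h
  · have h2 := congrArg Prod.fst (P.adjacent i _ hi (by rw [← h] at hj; exact hj))
    rw [point_eq] at h2
    simp only [Prod.fst_add, Prod.smul_fst, smul_eq_mul, add_eq_left, mul_eq_zero, hd,
      or_false] at h2
    linarith
  · rcases Nat.eq_or_lt_of_le (Nat.succ_le_of_lt hji) with h' | h'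
    · rw [← P.edge_periodic, ← h'] at hi
      have h2 := congrArg Prod.fst (P.adjacent j _ hj hi)
      rw [show j + 1 = i + n from h', P.periodic, point_fst] at h2
      simp only [add_eq_left, mul_eq_zero, hd, or_false] at h2
      linarith
    · exact P.disjoint i j h h' _ hi hj

lemma eventually_side_eq_zero (i : ℕ) {t : ℝ} (h0 : 0 < t) (h1 : t < 1) :
    ∀ᶠ z in nhds (P.point i t), z ∈ P.boundary → P.side i z = 0 := by
  filter_upwards [P.eventually_mem_edge (P.point i t)] with z hz ⟨j, hj⟩
  obtain ⟨k, hik, hk, e⟩ := P.exists_window i j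
  rw [e] at hj
  rcases hik.eq_or_lt with rfl | h
  · exact P.side_eq_zero hj
  · exact (P.point_notMem_edge h hk h0 h1 (hz k hj)).elim

lemma vert_succ_mem (i : ℕ) : P.vert (i + 1) ∈ P.edge i := right_mem_segment _ _ _

lemma eventually_mem_edge_vert (i : ℕ) :
    ∀ᶠ z in nhds (P.vert (i + 1)), z ∈ P.boundary → z ∈ P.edge i ∨ z ∈ P.edge (i + 1) := by
  filter_upwards [P.eventually_mem_edge (P.vert (i + 1))] with z hz ⟨j, hj⟩
  obtain ⟨k, hik, hk, e⟩ := P.exists_window i j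
  rw [e] at hj
  have h3 := P.three_le
  rcases hik.eq_or_lt with rfl | h
  · exact Or.inl hj
  · rcases Nat.eq_or_lt_of_le (Nat.succ_le_of_lt h) with h | h
    · subst h
      exact Or.inr hj
    · exfalso
      have hi := P.vert_succ_mem i
      rcases Nat.eq_or_lt_of_le (Nat.succ_le_of_lt hk) with h' | h'
      · rw [← P.edge_periodic, ← h'] at hi
        have h2 := congrArg Prod.fst (P.adjacent k _ (hz k hj) hi)
        rw [show k + 1 = i + n from h', P.periodic] at h2
        exact P.fst_ne i (i + 1) (by omega) (by omega) h2.symm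
      · exact P.disjoint i k h h' _ hi (hz k hj)

/-- A function is constant on convex sets avoiding the boundary. -/
def LocallyConst (f : ℝ × ℝ → ℝ) : Prop :=
  ∀ K : Set (ℝ × ℝ), Convex ℝ K → (∀ z ∈ K, z ∉ P.boundary) → ∀ z ∈ K, ∀ w ∈ K, f z = f w

variable {P} in
lemma LocallyConst.exists_ball {f : ℝ × ℝ → ℝ} (hf : P.LocallyConst f) {q : ℝ × ℝ}
    {C : Set (ℝ × ℝ)} (hC : Convex ℝ C) (h : ∀ᶠ z in nhds q, z ∈ C → z ∉ P.boundary) :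
    ∃ U ∈ nhds q, ∀ z ∈ U, z ∈ C → ∀ w ∈ U, w ∈ C → f z = f w := by
  obtain ⟨r, hr, hb⟩ := Metric.eventually_nhds_iff_ball.1 h
  refine ⟨_, Metric.ball_mem_nhds q hr, fun z hz hz' w hw hw' ↦
    hf (Metric.ball q r ∩ C) ((convex_ball q r).inter hC) (fun z hz ↦ hb z hz.1 hz.2) z ⟨hz, hz'⟩
      w ⟨hw, hw'⟩⟩

lemma convex_side (ε : ℝ) (i : ℕ) : Convex ℝ {z | 0 < ε * P.side i z} := by
  have h : {z | 0 < ε * P.side i z} = {z | ε * planeDet (P.dir i) (P.vert i) <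
      (ε • ((P.dir i).1 • LinearMap.snd ℝ ℝ ℝ - (P.dir i).2 • LinearMap.fst ℝ ℝ ℝ)) z} := by
    ext z
    simp only [side, planeDet, Set.mem_ofPred_eq, Prod.fst_sub, Prod.snd_sub,
      LinearMap.smul_apply, LinearMap.sub_apply, LinearMap.fst_apply, LinearMap.snd_apply,
      smul_eq_mul]
    constructor <;> intro h <;> linarith
  rw [h]
  exact convex_halfSpace_gt (LinearMap.isLinear _) _

lemma frequently_nhds_of_ray {q v : ℝ × ℝ} {p : ℝ × ℝ → Prop}
    (h : ∀ t : ℝ, 0 < t → p (q + t • v)) : ∃ᶠ z in nhds q, p z := by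
  have ht : Filter.Tendsto (fun t : ℝ ↦ q + t • v) (nhdsWithin 0 (Set.Ioi 0)) (nhds q) := by
    have h : ContinuousAt (fun t : ℝ ↦ q + t • v) 0 := by fun_prop
    have h' := h.tendsto
    simp only [zero_smul, add_zero] at h'
    exact h'.mono_left nhdsWithin_le_nhds
  exact ht.frequently (Filter.Eventually.frequently
    (eventually_nhdsWithin_of_forall fun t ht ↦ h t ht))

lemma frequently_side_pos {ε : ℝ} (hε : ε ≠ 0) {i : ℕ} {q : ℝ × ℝ} (hq : P.side i q = 0) :
    ∃ᶠ z in nhds q, 0 < ε * P.side i z := by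
  refine frequently_nhds_of_ray (v := (0, ε * (P.dir i).1)) fun t ht ↦ ?_
  rw [side_add_smul, hq]
  have h1 : 0 < (ε * (P.dir i).1) ^ 2 := by
    have := P.dir_fst_ne i
    positivity
  have h2 : planeDet (P.dir i) (0, ε * (P.dir i).1) = ε * (P.dir i).1 ^ 2 := by
    simp [planeDet]
    ring
  rw [h2]
  have h3 : ε * (0 + t * (ε * (P.dir i).1 ^ 2)) = t * (ε * (P.dir i).1) ^ 2 := by ring
  rw [h3]
  positivity

/-- The function `f` takes the value `c` next to edge `i`, on its left if `0 < ε` and on its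
right if `ε < 0`. -/
def OnSide (f : ℝ × ℝ → ℝ) (ε c : ℝ) (i : ℕ) : Prop :=
  ∀ t, 0 < t → t < 1 → ∀ᶠ z in nhds (P.point i t), 0 < ε * P.side i z → f z = c

variable {P}

lemma LocallyConst.exists_side_value {f : ℝ × ℝ → ℝ} (hf : P.LocallyConst f) {ε : ℝ} (hε : ε ≠ 0)
    (i : ℕ) {t : ℝ} (h0 : 0 < t) (h1 : t < 1) :
    ∃ c, ∀ᶠ z in nhds (P.point i t), 0 < ε * P.side i z → f z = c := by
  obtain ⟨U, hU, h⟩ := hf.exists_ball (P.convex_side ε i) (q := P.point i t) (by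
    filter_upwards [P.eventually_side_eq_zero i h0 h1] with z hz hz' hb
    simp [hz hb] at hz')
  obtain ⟨w, hw, hwU⟩ := ((P.frequently_side_pos hε (P.side_point i t)).and_eventually hU).exists
  refine ⟨f w, ?_⟩
  filter_upwards [hU] with z hz hz'
  exact h z hz hz' w hwU hw

lemma LocallyConst.onSide {f : ℝ × ℝ → ℝ} (hf : P.LocallyConst f) {ε c : ℝ} (hε : ε ≠ 0)
    {i : ℕ} {t : ℝ} (h0 : 0 < t) (h1 : t < 1)
    (h : ∀ᶠ z in nhds (P.point i t), 0 < ε * P.side i z → f z = c) : P.OnSide f ε c i := by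
  have key : ∀ x ∈ Set.Ioo (0 : ℝ) 1, ∃ c', ∀ᶠ y in nhds x,
      ∀ᶠ z in nhds (P.point i y), 0 < ε * P.side i z → f z = c' := by
    intro x hx
    obtain ⟨c', hc'⟩ := hf.exists_side_value hε i hx.1 hx.2
    exact ⟨c', (P.continuous_point i).continuousAt.eventually hc'.eventually_nhds⟩
  have uniq : ∀ x c₁ c₂, (∀ᶠ z in nhds (P.point i x), 0 < ε * P.side i z → f z = c₁) →
      (∀ᶠ z in nhds (P.point i x), 0 < ε * P.side i z → f z = c₂) → c₁ = c₂ := by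
    intro x c₁ c₂ h₁ h₂
    obtain ⟨z, hz, hz₁, hz₂⟩ :=
      ((P.frequently_side_pos hε (P.side_point i x)).and_eventually (h₁.and h₂)).exists
    rw [← hz₁ hz, hz₂ hz]
  intro s hs0 hs1
  obtain ⟨c', hc₁, hc₂⟩ := isPreconnected_Ioo.induction₂ (s := Set.Ioo (0 : ℝ) 1)
    (fun x y ↦ ∃ c', (∀ᶠ z in nhds (P.point i x), 0 < ε * P.side i z → f z = c') ∧
      (∀ᶠ z in nhds (P.point i y), 0 < ε * P.side i z → f z = c'))
    (fun x hx ↦ by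
      obtain ⟨c', hc'⟩ := key x hx
      filter_upwards [nhdsWithin_le_nhds hc'] with y hy
      exact ⟨c', hc'.self_of_nhds, hy⟩)
    (fun x y z _ _ _ ⟨c₁, h₁, h₁'⟩ ⟨c₂, h₂, h₂'⟩ ↦
      ⟨c₁, h₁, by rwa [uniq y _ _ h₁' h₂]⟩)
    (fun x y _ _ ⟨c', h₁, h₂⟩ ↦ ⟨c', h₂, h₁⟩) ⟨h0, h1⟩ ⟨hs0, hs1⟩
  rwa [uniq t _ _ h hc₁]

variable (P) in
/-- The sector at the vertex `i + 1` on the left (`0 < ε`) or right (`ε < 0`) of the polygon. -/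
def Sector (ε : ℝ) (i : ℕ) (z : ℝ × ℝ) : Prop :=
  if 0 < ε * P.turnDet i then 0 < ε * P.side i z ∧ 0 < ε * P.side (i + 1) z
  else 0 < ε * P.side i z ∨ 0 < ε * P.side (i + 1) z

lemma eventually_ray {p : ℝ × ℝ → Prop} {q v : ℝ × ℝ} (h : ∀ᶠ z in nhds q, p z) :
    ∃ t : ℝ, 0 < t ∧ t < 1 ∧ p (q + t • v) := by
  have ht : Filter.Tendsto (fun t : ℝ ↦ q + t • v) (nhdsWithin 0 (Set.Ioi 0)) (nhds q) := by
    have h : ContinuousAt (fun t : ℝ ↦ q + t • v) 0 := by fun_prop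
    have h' := h.tendsto
    simp only [zero_smul, add_zero] at h'
    exact h'.mono_left nhdsWithin_le_nhds
  obtain ⟨t, hp, ht⟩ := ((ht.eventually h).and
    (Ioo_mem_nhdsGT (show (0 : ℝ) < 1 by norm_num))).exists
  exact ⟨t, ht.1, ht.2, hp⟩

lemma OnSide.exists_near_succ {f : ℝ × ℝ → ℝ} {ε c : ℝ} (hε : ε ≠ 0) {i : ℕ}
    (h : P.OnSide f ε c i) {U : Set (ℝ × ℝ)} (hU : U ∈ nhds (P.vert (i + 1))) :
    ∃ z ∈ U, f z = c ∧ 0 < ε * P.side i z ∧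
      (0 < ε * P.turnDet i → 0 < ε * P.side (i + 1) z) := by
  obtain ⟨t, h0, h1, ht⟩ := eventually_ray (v := -P.dir i)
    (Filter.Eventually.eventually_nhds (p := fun z ↦ z ∈ U) hU)
  have hp : P.vert (i + 1) + t • -P.dir i = P.point i (1 - t) := by
    rw [point_eq, smul_neg, ← neg_smul]
    congr 2
    ring
  rw [hp] at ht
  have h2 : ∀ᶠ z in nhds (P.point i (1 - t)),
      0 < ε * P.turnDet i → 0 < ε * P.side (i + 1) z := by
    by_cases hD : 0 < ε * P.turnDet i
    · have hc : Continuous fun z ↦ ε * P.side (i + 1) z := (P.continuous_side _).const_mul ε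
      have hpos : 0 < ε * P.side (i + 1) (P.point i (1 - t)) := by
        rw [side_succ_point]
        nlinarith [mul_pos h0 hD]
      filter_upwards [hc.continuousAt.eventually (lt_mem_nhds hpos)] with z hz _ using hz
    · exact Filter.Eventually.of_forall fun z hz ↦ (hD hz).elim
  obtain ⟨z, hz, hzU, hz₁, hz₂⟩ :=
    ((P.frequently_side_pos hε (P.side_point i (1 - t))).and_eventually
      (ht.and ((h _ (by linarith) (by linarith)).and h2))).exists
  exact ⟨z, hzU, hz₁ hz, hz, hz₂⟩

lemma dir_fst_mul_pos {i : ℕ} (hD : P.turnDet i = 0) :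
    0 < (P.dir i).1 * (P.dir (i + 1)).1 := by
  by_contra hcon
  have hlt : (P.dir i).1 * (P.dir (i + 1)).1 < 0 :=
    lt_of_le_of_ne (not_lt.1 hcon) (mul_ne_zero (P.dir_fst_ne _) (P.dir_fst_ne _))
  obtain ⟨h1, h2⟩ := abs_combination_eq_zero hlt hD
  have := P.dir_combination_eq_zero (i := i) (abs_nonneg _) (abs_nonneg _) (Prod.ext h1 h2)
  exact P.dir_fst_ne _ (abs_eq_zero.1 this.1)

/-- At a vertex which is not convex on the given side, the two half-planes overlap. -/
lemma frequently_both_sides {ε : ℝ} (hε : ε ≠ 0) {i : ℕ} (hD : ¬0 < ε * P.turnDet i) :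
    ∃ᶠ z in nhds (P.vert (i + 1)), 0 < ε * P.side i z ∧ 0 < ε * P.side (i + 1) z := by
  obtain ⟨v, hv₁, hv₂⟩ : ∃ v, 0 < ε * planeDet (P.dir i) v ∧
      0 < ε * planeDet (P.dir (i + 1)) v := by
    rcases eq_or_ne (P.turnDet i) 0 with h0 | h0
    · have hx := dir_fst_mul_pos h0
      have e := P.dir_fst_ne i
      refine ⟨(0, ε * (P.dir i).1), ?_, ?_⟩
      · have : ε * planeDet (P.dir i) (0, ε * (P.dir i).1) = (ε * (P.dir i).1) ^ 2 := by
          simp [planeDet]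
          ring
        rw [this]
        positivity
      · have : ε * planeDet (P.dir (i + 1)) (0, ε * (P.dir i).1) =
            ε ^ 2 * ((P.dir i).1 * (P.dir (i + 1)).1) := by
          simp [planeDet]
          ring
        rw [this]
        positivity
    · have hlt : ε * P.turnDet i < 0 := lt_of_le_of_ne (not_lt.1 hD) (mul_ne_zero hε h0)
      unfold turnDet planeDet at hlt
      refine ⟨P.dir i - P.dir (i + 1), ?_, ?_⟩ <;>
      · simp only [planeDet, Prod.fst_sub, Prod.snd_sub]
        linarith
  refine frequently_nhds_of_ray (v := v) fun t ht ↦ ?_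
  rw [side_add_smul, side_add_smul, side_vert_succ, side_vert]
  constructor
  · nlinarith [mul_pos ht hv₁]
  · nlinarith [mul_pos ht hv₂]

variable (P) in
lemma eventually_notMem_boundary_vert {C : Set (ℝ × ℝ)} (i : ℕ)
    (h₁ : ∀ t, 0 ≤ t → t ≤ 1 → P.point i t ∉ C)
    (h₂ : ∀ t, 0 ≤ t → t ≤ 1 → P.point (i + 1) t ∉ C) :
    ∀ᶠ z in nhds (P.vert (i + 1)), z ∈ C → z ∉ P.boundary := by
  filter_upwards [P.eventually_mem_edge_vert i] with z hz hC hb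
  rcases hz hb with h | h <;> obtain ⟨t, h0, h1, rfl⟩ := P.mem_edge.1 h
  · exact h₁ t h0 h1 hC
  · exact h₂ t h0 h1 hC

lemma LocallyConst.sector {f : ℝ × ℝ → ℝ} (hf : P.LocallyConst f) {ε c : ℝ} (hε : ε ≠ 0)
    {i : ℕ} (h : P.OnSide f ε c i) :
    ∀ᶠ z in nhds (P.vert (i + 1)), P.Sector ε i z → f z = c := by
  by_cases hD : 0 < ε * P.turnDet i
  · obtain ⟨U, hU, hUc⟩ := hf.exists_ball ((P.convex_side ε i).inter (P.convex_side ε (i + 1)))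
      (P.eventually_notMem_boundary_vert i
        (fun t _ _ ht ↦ by simpa [side_point] using ht.1)
        (fun t _ _ ht ↦ by simpa [side_point] using ht.2))
    obtain ⟨w, hw, hwc, hw₁, hw₂⟩ := h.exists_near_succ hε hU
    filter_upwards [hU] with z hz hs
    rw [Sector, if_pos hD] at hs
    rw [← hwc]
    exact hUc z hz hs w hw ⟨hw₁, hw₂ hD⟩
  · have hb₁ : ∀ t, 0 ≤ t → ¬0 < ε * (t * P.turnDet i) := by
      intro t ht
      nlinarith [mul_nonneg ht (neg_nonneg.2 (not_lt.1 hD))]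
    obtain ⟨U, hU, hUc⟩ := hf.exists_ball (P.convex_side ε i)
      (P.eventually_notMem_boundary_vert i
        (fun t _ _ ht ↦ by simp [side_point] at ht)
        (fun t h0 _ ht ↦ hb₁ t h0 (by simpa [side_point_succ] using ht)))
    obtain ⟨U', hU', hUc'⟩ := hf.exists_ball (P.convex_side ε (i + 1))
      (P.eventually_notMem_boundary_vert i
        (fun t _ h1 ht ↦ hb₁ (1 - t) (by linarith) (by simpa [side_succ_point] using ht))
        (fun t _ _ ht ↦ by simp [side_point] at ht))
    obtain ⟨w, hw, hwc, hw₁, -⟩ := h.exists_near_succ hε hU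
    obtain ⟨y, ⟨hy₁, hy₂⟩, hy, hy'⟩ := ((frequently_both_sides hε hD).and_eventually
      (Filter.Eventually.and hU hU')).exists
    filter_upwards [hU, hU'] with z hz hz' hs
    rw [Sector, if_neg hD] at hs
    rw [← hwc]
    rcases hs with hs | hs
    · exact hUc z hz hs w hw hw₁
    · rw [hUc' z hz' hs y hy' hy₂]
      exact hUc y hy hy₁ w hw hw₁

lemma LocallyConst.onSide_succ {f : ℝ × ℝ → ℝ} (hf : P.LocallyConst f) {ε c : ℝ} (hε : ε ≠ 0)
    {i : ℕ} (h : P.OnSide f ε c i) : P.OnSide f ε c (i + 1) := by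
  obtain ⟨t, h0, h1, ht⟩ := eventually_ray (v := P.dir (i + 1))
    (hf.sector hε h).eventually_nhds
  refine hf.onSide hε h0 h1 ?_
  change ∀ᶠ z in nhds (P.point (i + 1) t), _ at ht
  by_cases hD : 0 < ε * P.turnDet i
  · have hc : Continuous fun z ↦ ε * P.side i z := (P.continuous_side _).const_mul ε
    have hpos : 0 < ε * P.side i (P.point (i + 1) t) := by
      rw [side_point_succ]
      nlinarith [mul_pos h0 hD]
    filter_upwards [ht, hc.continuousAt.eventually (lt_mem_nhds hpos)] with z hz hz' hs
    exact hz (by rw [Sector, if_pos hD]; exact ⟨hz', hs⟩)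
  · filter_upwards [ht] with z hz hs
    exact hz (by rw [Sector, if_neg hD]; exact Or.inr hs)

/-- A locally constant function off the polygon has a constant value along each side of it. -/
lemma LocallyConst.exists_onSide {f : ℝ × ℝ → ℝ} (hf : P.LocallyConst f) {ε : ℝ} (hε : ε ≠ 0) :
    ∃ c, ∀ i, P.OnSide f ε c i := by
  obtain ⟨c, hc⟩ := hf.exists_side_value hε 0 (t := 1 / 2) (by norm_num) (by norm_num)
  refine ⟨c, fun i ↦ ?_⟩
  induction i with
  | zero => exact hf.onSide hε (by norm_num) (by norm_num) hc
  | succ i ih => exact hf.onSide_succ hε ih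

end GenericPolygon

namespace GenericPolygon

variable {n : ℕ} (P : GenericPolygon n)

/-- The height of the line through edge `i` above the abscissa `x`. -/
noncomputable def height (i : ℕ) (x : ℝ) : ℝ :=
  (P.vert i).2 + (P.dir i).2 / (P.dir i).1 * (x - (P.vert i).1)

/-- The signed indicator of the projection of edge `i` to the horizontal axis, with weight `1 / 2`
at the end points. -/
noncomputable def span (i : ℕ) (x : ℝ) : ℝ :=
  (Real.sign (x - (P.vert i).1) - Real.sign (x - (P.vert (i + 1)).1)) / 2

/-- The contribution of edge `i` to the winding number around `z`. -/
noncomputable def crossing (i : ℕ) (z : ℝ × ℝ) : ℝ :=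
  P.span i z.1 * Real.sign (z.2 - P.height i z.1) / 2

/-- The winding number of the polygon, with symmetric weights on the polygon. -/
noncomputable def winding (z : ℝ × ℝ) : ℝ := ∑ i ∈ Finset.range n, P.crossing i z

lemma side_eq (i : ℕ) (z : ℝ × ℝ) :
    P.side i z = (P.dir i).1 * (z.2 - P.height i z.1) := by
  have := P.dir_fst_ne i
  simp only [side, planeDet, height, Prod.fst_sub, Prod.snd_sub]
  field_simp
  ring

lemma dir_fst (i : ℕ) : (P.dir i).1 = (P.vert (i + 1)).1 - (P.vert i).1 := by
  simp [dir, secant]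

lemma dir_snd (i : ℕ) : (P.dir i).2 = (P.vert (i + 1)).2 - (P.vert i).2 := by
  simp [dir, secant]

lemma point_snd (i : ℕ) (t : ℝ) : (P.point i t).2 = P.height i (P.point i t).1 := by
  have := P.dir_fst_ne i
  simp only [point, height, Prod.fst_add, Prod.snd_add, Prod.smul_fst, Prod.smul_snd, smul_eq_mul]
  field_simp
  ring

lemma mem_edge_iff {i : ℕ} {z : ℝ × ℝ} : z ∈ P.edge i ↔ z.2 = P.height i z.1 ∧
    (z.1 - (P.vert i).1) * (z.1 - (P.vert (i + 1)).1) ≤ 0 := by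
  have hd := P.dir_fst_ne i
  have hd' := P.dir_fst i
  have hd2 : 0 < (P.dir i).1 ^ 2 := by positivity
  rw [mem_edge]
  constructor
  · rintro ⟨t, h0, h1, rfl⟩
    refine ⟨P.point_snd i t, ?_⟩
    rw [point_fst]
    have e : ((P.vert i).1 + t * (P.dir i).1 - (P.vert i).1) *
        ((P.vert i).1 + t * (P.dir i).1 - (P.vert (i + 1)).1) =
        -(t * (1 - t) * (P.dir i).1 ^ 2) := by
      rw [show (P.vert (i + 1)).1 = (P.vert i).1 + (P.dir i).1 by linarith]
      ring
    rw [e]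
    have : 0 ≤ t * (1 - t) * (P.dir i).1 ^ 2 :=
      mul_nonneg (mul_nonneg h0 (by linarith)) hd2.le
    linarith
  · rintro ⟨hz, hx⟩
    set t := (z.1 - (P.vert i).1) / (P.dir i).1 with ht
    have h1 : (P.point i t).1 = z.1 := by
      rw [point_fst, ht]
      field_simp
      ring
    have e : t * (t - 1) * (P.dir i).1 ^ 2 ≤ 0 := by
      have e1 : t * (P.dir i).1 = z.1 - (P.vert i).1 := by rw [ht]; field_simp
      calc t * (t - 1) * (P.dir i).1 ^ 2
          = (t * (P.dir i).1) * (t * (P.dir i).1 - (P.dir i).1) := by ring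
        _ = (z.1 - (P.vert i).1) * (z.1 - (P.vert (i + 1)).1) := by rw [e1, hd']; ring
        _ ≤ 0 := hx
    have e2 : t * (t - 1) ≤ 0 := by
      by_contra hcon
      exact absurd (mul_pos (not_le.1 hcon) hd2) (not_lt.2 e)
    refine ⟨t, by nlinarith, by nlinarith, Prod.ext h1 ?_⟩
    rw [point_snd, h1, hz]

lemma sign_eq_of_mul_pos {a b : ℝ} (h : 0 < a * b) : Real.sign a = Real.sign b := by
  rcases pos_and_pos_or_neg_and_neg_of_mul_pos h with ⟨h1, h2⟩ | ⟨h1, h2⟩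
  · rw [Real.sign_of_pos h1, Real.sign_of_pos h2]
  · rw [Real.sign_of_neg h1, Real.sign_of_neg h2]

lemma span_eq_zero {i : ℕ} {x : ℝ} (h : 0 < (x - (P.vert i).1) * (x - (P.vert (i + 1)).1)) :
    P.span i x = 0 := by
  rw [span, sign_eq_of_mul_pos h, sub_self, zero_div]

lemma span_eq_sign {i : ℕ} {x : ℝ} (h : (x - (P.vert i).1) * (x - (P.vert (i + 1)).1) < 0) :
    P.span i x = Real.sign (P.dir i).1 := by
  rw [span, dir_fst]
  rcases mul_neg_iff.1 h with ⟨h1, h2⟩ | ⟨h1, h2⟩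
  · rw [Real.sign_of_pos h1, Real.sign_of_neg h2, Real.sign_of_pos (by linarith)]
    norm_num
  · rw [Real.sign_of_neg h1, Real.sign_of_pos h2, Real.sign_of_neg (by linarith)]
    norm_num

lemma continuous_height (i : ℕ) : Continuous (P.height i) := by
  unfold height
  fun_prop

lemma sum_span (x : ℝ) : ∑ i ∈ Finset.range n, P.span i x = 0 := by
  have h0 : P.vert n = P.vert 0 := by simpa using P.periodic 0
  unfold span
  rw [← Finset.sum_div, Finset.sum_range_sub' (fun i ↦ Real.sign (x - (P.vert i).1)), h0, sub_self,
    zero_div]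

lemma eventually_sign_eq {a : ℝ} (ha : a ≠ 0) : ∀ᶠ b in nhds a, Real.sign b = Real.sign a := by
  rcases lt_or_gt_of_ne ha with h | h
  · filter_upwards [gt_mem_nhds h] with b hb
    rw [Real.sign_of_neg h, Real.sign_of_neg hb]
  · filter_upwards [lt_mem_nhds h] with b hb
    rw [Real.sign_of_pos h, Real.sign_of_pos hb]

lemma eventually_sign_add_sub (a : ℝ) : ∀ᶠ h in nhdsWithin (0 : ℝ) (Set.Ioi 0),
    Real.sign (a + h) + Real.sign (a - h) = 2 * Real.sign a := by
  rcases eq_or_ne a 0 with rfl | ha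
  · refine eventually_nhdsWithin_of_forall fun h hh ↦ ?_
    rw [zero_add, zero_sub, Real.sign_neg, Real.sign_zero]
    ring
  · have h1 : ContinuousAt (fun h : ℝ ↦ a + h) 0 := by fun_prop
    have h2 : ContinuousAt (fun h : ℝ ↦ a - h) 0 := by fun_prop
    have e1 := h1.eventually (p := fun b ↦ Real.sign b = Real.sign a)
      (by simpa using eventually_sign_eq ha)
    have e2 := h2.eventually (p := fun b ↦ Real.sign b = Real.sign a)
      (by simpa using eventually_sign_eq ha)
    filter_upwards [nhdsWithin_le_nhds e1, nhdsWithin_le_nhds e2] with h hh1 hh2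
    rw [hh1, hh2]
    ring

lemma eventually_ne_nhdsGT (k : ℝ) : ∀ᶠ h in nhdsWithin (0 : ℝ) (Set.Ioi 0), h ≠ k := by
  rcases eq_or_ne k 0 with rfl | hk
  · exact eventually_nhdsWithin_of_forall fun h hh ↦ ne_of_gt hh
  · exact nhdsWithin_le_nhds (isOpen_ne.mem_nhds hk.symm)

/-- The winding number is the average of its values just above and just below. -/
lemma eventually_winding_vertical (z : ℝ × ℝ) : ∀ᶠ h in nhdsWithin (0 : ℝ) (Set.Ioi 0),
    P.winding (z.1, z.2 + h) + P.winding (z.1, z.2 - h) = 2 * P.winding z := by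
  have key : ∀ᶠ h in nhdsWithin (0 : ℝ) (Set.Ioi 0), ∀ i ∈ Finset.range n,
      P.crossing i (z.1, z.2 + h) + P.crossing i (z.1, z.2 - h) = 2 * P.crossing i z := by
    rw [Filter.eventually_all_finset]
    intro i _
    filter_upwards [eventually_sign_add_sub (z.2 - P.height i z.1)] with h hh
    simp only [crossing]
    rw [show z.2 + h - P.height i z.1 = z.2 - P.height i z.1 + h by ring,
      show z.2 - h - P.height i z.1 = z.2 - P.height i z.1 - h by ring]
    linear_combination (P.span i z.1) / 2 * hh
  filter_upwards [key] with h hh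
  simp only [winding]
  rw [← Finset.sum_add_distrib, Finset.mul_sum]
  exact Finset.sum_congr rfl hh

/-- Off the polygon, the winding number is the average of its values just to the right and just
to the left. -/
lemma eventually_winding_horizontal {z : ℝ × ℝ} (hz : z ∉ P.boundary) :
    ∀ᶠ h in nhdsWithin (0 : ℝ) (Set.Ioi 0),
      P.winding (z.1 + h, z.2) + P.winding (z.1 - h, z.2) = 2 * P.winding z := by
  have c1 : Filter.Tendsto (fun h : ℝ ↦ z.1 + h) (nhdsWithin 0 (Set.Ioi 0)) (nhds z.1) := by
    have : ContinuousAt (fun h : ℝ ↦ z.1 + h) 0 := by fun_prop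
    simpa using this.tendsto.mono_left nhdsWithin_le_nhds
  have c2 : Filter.Tendsto (fun h : ℝ ↦ z.1 - h) (nhdsWithin 0 (Set.Ioi 0)) (nhds z.1) := by
    have : ContinuousAt (fun h : ℝ ↦ z.1 - h) 0 := by fun_prop
    simpa using this.tendsto.mono_left nhdsWithin_le_nhds
  have key : ∀ᶠ h in nhdsWithin (0 : ℝ) (Set.Ioi 0), ∀ i ∈ Finset.range n,
      P.crossing i (z.1 + h, z.2) + P.crossing i (z.1 - h, z.2) = 2 * P.crossing i z := by
    rw [Filter.eventually_all_finset]
    intro i _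
    by_cases hy : z.2 = P.height i z.1
    · have hx : 0 < (z.1 - (P.vert i).1) * (z.1 - (P.vert (i + 1)).1) := by
        by_contra hcon
        exact hz ⟨i, P.mem_edge_iff.2 ⟨hy, not_lt.1 hcon⟩⟩
      have hc : ContinuousAt (fun x ↦ (x - (P.vert i).1) * (x - (P.vert (i + 1)).1)) z.1 := by
        fun_prop
      have e := hc.eventually (lt_mem_nhds hx)
      filter_upwards [c1.eventually e, c2.eventually e] with h h1 h2
      simp only [crossing]
      rw [P.span_eq_zero h1, P.span_eq_zero h2, P.span_eq_zero hx]
      ring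
    · have hc : ContinuousAt (fun x ↦ z.2 - P.height i x) z.1 :=
        (continuous_const.sub (P.continuous_height i)).continuousAt
      have e := hc.eventually (eventually_sign_eq (sub_ne_zero.2 hy))
      filter_upwards [c1.eventually e, c2.eventually e,
        eventually_sign_add_sub (z.1 - (P.vert i).1),
        eventually_sign_add_sub (z.1 - (P.vert (i + 1)).1)] with h h1 h2 h3 h4
      simp only [crossing, span]
      rw [h1, h2, show z.1 + h - (P.vert i).1 = z.1 - (P.vert i).1 + h by ring,
        show z.1 - h - (P.vert i).1 = z.1 - (P.vert i).1 - h by ring,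
        show z.1 + h - (P.vert (i + 1)).1 = z.1 - (P.vert (i + 1)).1 + h by ring,
        show z.1 - h - (P.vert (i + 1)).1 = z.1 - (P.vert (i + 1)).1 - h by ring]
      linear_combination (Real.sign (z.2 - P.height i z.1) / 4) * (h3 - h4)
  filter_upwards [key] with h hh
  simp only [winding]
  rw [← Finset.sum_add_distrib, Finset.mul_sum]
  exact Finset.sum_congr rfl hh

lemma eventually_crossing_eq {i : ℕ} {z : ℝ × ℝ} (hz : z ∉ P.edge i)
    (hx : (z.1 - (P.vert i).1) * (z.1 - (P.vert (i + 1)).1) ≠ 0) :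
    ∀ᶠ y in nhds z.2, P.crossing i (z.1, y) = P.crossing i z := by
  rcases lt_or_gt_of_ne hx with h | h
  · have hy : z.2 - P.height i z.1 ≠ 0 := fun h0 ↦
      hz (P.mem_edge_iff.2 ⟨sub_eq_zero.1 h0, h.le⟩)
    have hc : ContinuousAt (fun y ↦ y - P.height i z.1) z.2 := by fun_prop
    filter_upwards [hc.eventually (eventually_sign_eq hy)] with y h1
    simp only [crossing]
    rw [h1]
  · exact Filter.Eventually.of_forall fun y ↦ by simp [crossing, P.span_eq_zero h]

lemma eventually_notMem_boundary {z : ℝ × ℝ} (hz : z ∉ P.boundary) :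
    ∀ᶠ w in nhds z, w ∉ P.boundary := by
  filter_upwards [P.eventually_mem_edge z] with w hw ⟨i, hi⟩
  exact hz ⟨i, hw i hi⟩

lemma notMem_edge_of_ne {i j : ℕ} (hi : i < n) (hj : j < n) (hij : j ≠ i) {t : ℝ} (h0 : 0 < t)
    (h1 : t < 1) : P.point i t ∉ P.edge j := by
  rcases lt_or_gt_of_ne hij with h | h
  · rw [← P.edge_periodic]
    exact P.point_notMem_edge (by omega) (by omega) h0 h1
  · exact P.point_notMem_edge h (by omega) h0 h1

variable {P}

lemma LocallyConst.exists_const_punctured {f : ℝ × ℝ → ℝ} (hf : P.LocallyConst f) {cL cR : ℝ}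
    (hL : ∀ i, P.OnSide f 1 cL i) (hR : ∀ i, P.OnSide f (-1) cR i) {x : ℝ}
    (hx : ∀ i, x ≠ (P.vert i).1) (y₀ : ℝ) :
    ∃ c, (∀ᶠ y in nhdsWithin y₀ {y₀}ᶜ, f (x, y) - (cL - cR) * P.winding (x, y) = c) ∧
      ((x, y₀) ∉ P.boundary → f (x, y₀) - (cL - cR) * P.winding (x, y₀) = c) := by
  have hx' : ∀ i, (x - (P.vert i).1) * (x - (P.vert (i + 1)).1) ≠ 0 := fun i ↦
    mul_ne_zero (sub_ne_zero.2 (hx _)) (sub_ne_zero.2 (hx _))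
  have hcont : ContinuousAt (fun y : ℝ ↦ (x, y)) y₀ := by fun_prop
  by_cases hb : (x, y₀) ∈ P.boundary
  · obtain ⟨j, hj⟩ := hb
    obtain ⟨i, hi, hi'⟩ : ∃ i, i < n ∧ (x, y₀) ∈ P.edge i :=
      ⟨j % n, Nat.mod_lt _ P.n_pos, by rwa [P.edge_mod]⟩
    obtain ⟨t, h0, h1, ht⟩ := P.mem_edge.1 hi'
    have h0 : 0 < t := h0.lt_of_ne (by
      rintro rfl
      exact hx i (by simpa [point] using (congrArg Prod.fst ht).symm))
    have h1 : t < 1 := h1.lt_of_ne (by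
      rintro rfl
      rw [point_one] at ht
      exact hx (i + 1) (congrArg Prod.fst ht).symm)
    have hy : y₀ = P.height i x := (P.mem_edge_iff.1 hi').1
    have hlt := lt_of_le_of_ne (P.mem_edge_iff.1 hi').2 (hx' i)
    refine ⟨(cL + cR) / 2 - (cL - cR) * ∑ j ∈ (Finset.range n).erase i, P.crossing j (x, y₀), ?_,
      fun h ↦ (h ⟨j, hj⟩).elim⟩
    have hothers : ∀ᶠ y in nhds y₀, ∀ j ∈ (Finset.range n).erase i,
        P.crossing j (x, y) = P.crossing j (x, y₀) := by
      rw [Filter.eventually_all_finset]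
      intro j hj
      obtain ⟨hji, hjn⟩ := Finset.mem_erase.1 hj
      refine P.eventually_crossing_eq (z := (x, y₀)) ?_ (hx' j)
      rw [← ht]
      exact P.notMem_edge_of_ne hi (Finset.mem_range.1 hjn) hji h0 h1
    have eL := hL i t h0 h1
    have eR := hR i t h0 h1
    rw [ht] at eL eR
    filter_upwards [nhdsWithin_le_nhds hothers, nhdsWithin_le_nhds (hcont.eventually eL),
      nhdsWithin_le_nhds (hcont.eventually eR), self_mem_nhdsWithin] with y h1 h2 h3 h4
    have hne : y - y₀ ≠ 0 := sub_ne_zero.2 h4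
    rw [winding, ← Finset.add_sum_erase _ _ (Finset.mem_range.2 hi), Finset.sum_congr rfl h1]
    have hfi : f (x, y) - (cL - cR) * P.crossing i (x, y) = (cL + cR) / 2 := by
      rw [crossing, P.span_eq_sign hlt]
      simp only [P.side_eq, ← hy] at h2 h3 ⊢
      rcases lt_or_gt_of_ne hne with hn | hn <;> rcases lt_or_gt_of_ne (P.dir_fst_ne i) with hd | hd
      · rw [h2 (by nlinarith), Real.sign_of_neg hn, Real.sign_of_neg hd]
        ring
      · rw [h3 (by nlinarith), Real.sign_of_neg hn, Real.sign_of_pos hd]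
        ring
      · rw [h3 (by nlinarith), Real.sign_of_pos hn, Real.sign_of_neg hd]
        ring
      · rw [h2 (by nlinarith), Real.sign_of_pos hn, Real.sign_of_pos hd]
        ring
    linear_combination hfi
  · have hothers : ∀ᶠ y in nhds y₀, ∀ j ∈ Finset.range n,
        P.crossing j (x, y) = P.crossing j (x, y₀) := by
      rw [Filter.eventually_all_finset]
      intro j _
      exact P.eventually_crossing_eq (z := (x, y₀)) (fun h ↦ hb ⟨j, h⟩) (hx' j)
    obtain ⟨U, hU, hUc⟩ := hf.exists_ball (C := Set.univ) convex_univ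
      ((P.eventually_notMem_boundary hb).mono fun _ h _ ↦ h)
    refine ⟨_, ?_, fun _ ↦ rfl⟩
    filter_upwards [nhdsWithin_le_nhds hothers, nhdsWithin_le_nhds (hcont.eventually hU)]
      with y h1 h2
    rw [hUc _ h2 trivial _ (mem_of_mem_nhds hU) trivial, winding, winding, Finset.sum_congr rfl h1]

lemma LocallyConst.eq_winding_of_generic {f : ℝ × ℝ → ℝ} (hf : P.LocallyConst f) {cL cR : ℝ}
    (hL : ∀ i, P.OnSide f 1 cL i) (hR : ∀ i, P.OnSide f (-1) cR i)
    (hfar : ∃ M, ∀ z : ℝ × ℝ, z.2 < M → f z = 0) {z : ℝ × ℝ}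
    (hx : ∀ i, z.1 ≠ (P.vert i).1) (hz : z ∉ P.boundary) :
    f z = (cL - cR) * P.winding z := by
  obtain ⟨x, y⟩ := z
  simp only at hx
  have key := hf.exists_const_punctured hL hR hx
  set Φ : ℝ → ℝ := fun y ↦ f (x, y) - (cL - cR) * P.winding (x, y) with hΦ
  have hopen : ∀ s : Set ℝ, IsOpen {y₀ | ∀ᶠ y in nhdsWithin y₀ {y₀}ᶜ, Φ y ∈ s} := by
    intro s
    rw [isOpen_iff_mem_nhds]
    intro y₀ hy₀
    have h1 := eventually_eventually_nhdsWithin.2 hy₀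
    rw [eventually_nhdsWithin_iff] at h1
    filter_upwards [h1] with y hy
    by_cases hyy : y = y₀
    · rw [hyy]
      exact hy₀
    · have h2 := hy hyy
      rw [nhdsWithin_eq_nhds.2 (isOpen_compl_singleton.mem_nhds hyy)] at h2
      exact nhdsWithin_le_nhds h2
  have hcompl : {y₀ | ∀ᶠ y in nhdsWithin y₀ {y₀}ᶜ, Φ y ∈ ({0} : Set ℝ)}ᶜ =
      {y₀ | ∀ᶠ y in nhdsWithin y₀ {y₀}ᶜ, Φ y ∈ ({0} : Set ℝ)ᶜ} := by
    ext y₀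
    obtain ⟨c, hc, -⟩ := key y₀
    simp only [Set.mem_compl_iff, Set.mem_ofPred_eq, Set.mem_singleton_iff]
    constructor
    · intro h
      have hc0 : c ≠ 0 := by
        rintro rfl
        exact h hc
      exact hc.mono fun y hy ↦ by rw [hΦ]; simpa [hy] using hc0
    · intro h h'
      obtain ⟨y, h1, h2⟩ := (h.and h').exists
      exact h1 h2
  have hclopen : IsClopen {y₀ | ∀ᶠ y in nhdsWithin y₀ {y₀}ᶜ, Φ y ∈ ({0} : Set ℝ)} :=
    ⟨⟨hcompl ▸ hopen _⟩, hopen _⟩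
  have hne : {y₀ | ∀ᶠ y in nhdsWithin y₀ {y₀}ᶜ, Φ y ∈ ({0} : Set ℝ)}.Nonempty := by
    obtain ⟨M, hM⟩ := hfar
    have h1 : ∀ᶠ y in Filter.atBot, ∀ i ∈ Finset.range n, y < P.height i x := by
      rw [Filter.eventually_all_finset]
      exact fun i _ ↦ Filter.eventually_lt_atBot _
    obtain ⟨b, hb⟩ := Filter.eventually_atBot.1 (h1.and (Filter.eventually_lt_atBot M))
    refine ⟨b - 1, nhdsWithin_le_nhds ?_⟩
    filter_upwards [gt_mem_nhds (show b - 1 < b by linarith)] with y hy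
    obtain ⟨h2, h3⟩ := hb y hy.le
    have hw : P.winding (x, y) = 0 := by
      rw [winding, Finset.sum_congr rfl (g := fun i ↦ -(P.span i x) / 2), ← Finset.sum_div,
        Finset.sum_neg_distrib, P.sum_span]
      · simp
      · intro i hi
        simp only [crossing]
        rw [Real.sign_of_neg (sub_neg.2 (h2 i hi))]
        ring
    rw [hΦ]
    simp [hw, hM (x, y) h3]
  have huniv := hclopen.eq_univ hne
  have hy : ∀ᶠ y' in nhdsWithin y {y}ᶜ, Φ y' = 0 := by
    have : y ∈ {y₀ | ∀ᶠ y in nhdsWithin y₀ {y₀}ᶜ, Φ y ∈ ({0} : Set ℝ)} := huniv ▸ trivial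
    exact this
  obtain ⟨c, hc, hc'⟩ := key y
  obtain ⟨y', h1, h2⟩ := (hy.and hc).exists
  have := hc' hz
  have h3 : c = 0 := h2.symm.trans h1
  linarith

/-- The jump formula: a locally constant function with bounded support is a multiple of the
winding number. -/
lemma LocallyConst.eq_winding {f : ℝ × ℝ → ℝ} (hf : P.LocallyConst f) {cL cR : ℝ}
    (hL : ∀ i, P.OnSide f 1 cL i) (hR : ∀ i, P.OnSide f (-1) cR i)
    (hfar : ∃ M, ∀ z : ℝ × ℝ, z.2 < M → f z = 0) {z : ℝ × ℝ} (hz : z ∉ P.boundary) :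
    f z = (cL - cR) * P.winding z := by
  obtain ⟨U, hU, hUc⟩ := hf.exists_ball (C := Set.univ) convex_univ
    ((P.eventually_notMem_boundary hz).mono fun _ h _ ↦ h)
  have hV := Filter.inter_mem hU (P.eventually_notMem_boundary hz)
  have c1 : Filter.Tendsto (fun h : ℝ ↦ (z.1 + h, z.2)) (nhdsWithin 0 (Set.Ioi 0)) (nhds z) := by
    have : ContinuousAt (fun h : ℝ ↦ (z.1 + h, z.2)) 0 := by fun_prop
    simpa using this.tendsto.mono_left nhdsWithin_le_nhds
  have c2 : Filter.Tendsto (fun h : ℝ ↦ (z.1 - h, z.2)) (nhdsWithin 0 (Set.Ioi 0)) (nhds z) := by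
    have : ContinuousAt (fun h : ℝ ↦ (z.1 - h, z.2)) 0 := by fun_prop
    simpa using this.tendsto.mono_left nhdsWithin_le_nhds
  have hgen : ∀ᶠ h in nhdsWithin (0 : ℝ) (Set.Ioi 0), ∀ i ∈ Finset.range n,
      h ≠ (P.vert i).1 - z.1 ∧ h ≠ z.1 - (P.vert i).1 := by
    rw [Filter.eventually_all_finset]
    exact fun i _ ↦ (eventually_ne_nhdsGT _).and (eventually_ne_nhdsGT _)
  have hmod : ∀ i, P.vert (i % n) = P.vert i :=
    Function.Periodic.map_mod_nat P.periodic
  obtain ⟨h, h1, h2, h3, h4⟩ := ((c1.eventually hV).and ((c2.eventually hV).and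
    (hgen.and (P.eventually_winding_horizontal hz)))).exists
  have h5 : ∀ i, h ≠ (P.vert i).1 - z.1 ∧ h ≠ z.1 - (P.vert i).1 := fun i ↦ by
    rw [← hmod]
    exact h3 _ (Finset.mem_range.2 (Nat.mod_lt _ P.n_pos))
  have e1 := hf.eq_winding_of_generic hL hR hfar (z := (z.1 + h, z.2))
    (fun i hi ↦ (h5 i).1 (by simp only at hi; linarith)) h1.2
  have e2 := hf.eq_winding_of_generic hL hR hfar (z := (z.1 - h, z.2))
    (fun i hi ↦ (h5 i).2 (by simp only at hi; linarith)) h2.2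
  rw [hUc _ h1.1 trivial _ (mem_of_mem_nhds hU) trivial] at e1
  rw [hUc _ h2.1 trivial _ (mem_of_mem_nhds hU) trivial] at e2
  linear_combination (e1 + e2) / 2 + (cL - cR) / 2 * h4

/-- At every point, a multiple of the winding number is the average of the values of the function
just above and just below. -/
lemma LocallyConst.eventually_winding {f : ℝ × ℝ → ℝ} (hf : P.LocallyConst f) {cL cR : ℝ}
    (hL : ∀ i, P.OnSide f 1 cL i) (hR : ∀ i, P.OnSide f (-1) cR i)
    (hfar : ∃ M, ∀ z : ℝ × ℝ, z.2 < M → f z = 0) (z : ℝ × ℝ) :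
    ∀ᶠ h in nhdsWithin (0 : ℝ) (Set.Ioi 0),
      f (z.1, z.2 + h) + f (z.1, z.2 - h) = 2 * ((cL - cR) * P.winding z) := by
  have hgen : ∀ᶠ h in nhdsWithin (0 : ℝ) (Set.Ioi 0), ∀ i ∈ Finset.range n,
      h ≠ P.height i z.1 - z.2 ∧ h ≠ z.2 - P.height i z.1 := by
    rw [Filter.eventually_all_finset]
    exact fun i _ ↦ (eventually_ne_nhdsGT _).and (eventually_ne_nhdsGT _)
  filter_upwards [hgen, P.eventually_winding_vertical z] with h h1 h2
  have h3 : ∀ w : ℝ × ℝ, w.1 = z.1 → (w.2 = z.2 + h ∨ w.2 = z.2 - h) → w ∉ P.boundary := by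
    rintro w hw hw' ⟨i, hi⟩
    rw [← P.edge_mod, mem_edge_iff, hw] at hi
    obtain ⟨h4, h5⟩ := h1 (i % n) (Finset.mem_range.2 (Nat.mod_lt _ P.n_pos))
    rcases hw' with hw' | hw'
    · exact h4 (by linarith [hi.1])
    · exact h5 (by linarith [hi.1])
  rw [hf.eq_winding hL hR hfar (h3 (z.1, z.2 + h) rfl (Or.inl rfl)),
    hf.eq_winding hL hR hfar (h3 (z.1, z.2 - h) rfl (Or.inr rfl))]
  linear_combination (cL - cR) * h2

lemma tendsto_above (z : ℝ × ℝ) :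
    Filter.Tendsto (fun h : ℝ ↦ (z.1, z.2 + h)) (nhdsWithin 0 (Set.Ioi 0)) (nhds z) := by
  have : ContinuousAt (fun h : ℝ ↦ (z.1, z.2 + h)) 0 := by fun_prop
  simpa using this.tendsto.mono_left nhdsWithin_le_nhds

lemma tendsto_below (z : ℝ × ℝ) :
    Filter.Tendsto (fun h : ℝ ↦ (z.1, z.2 - h)) (nhdsWithin 0 (Set.Ioi 0)) (nhds z) := by
  have : ContinuousAt (fun h : ℝ ↦ (z.1, z.2 - h)) 0 := by fun_prop
  simpa using this.tendsto.mono_left nhdsWithin_le_nhds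

variable (P) in
lemma side_above (i : ℕ) (z : ℝ × ℝ) (h : ℝ) :
    P.side i (z.1, z.2 + h) = P.side i z + h * (P.dir i).1 := by
  simp only [side_eq]
  ring

/-- The winding number in the relative interior of an edge. -/
lemma LocallyConst.winding_point {f : ℝ × ℝ → ℝ} (hf : P.LocallyConst f) {cL cR : ℝ}
    (hL : ∀ i, P.OnSide f 1 cL i) (hR : ∀ i, P.OnSide f (-1) cR i)
    (hfar : ∃ M, ∀ z : ℝ × ℝ, z.2 < M → f z = 0) (i : ℕ) {t : ℝ} (h0 : 0 < t) (h1 : t < 1) :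
    (cL - cR) * P.winding (P.point i t) = (cL + cR) / 2 := by
  obtain ⟨h, e, a1, a2, b1, b2, hh⟩ := ((hf.eventually_winding hL hR hfar (P.point i t)).and
    (((tendsto_above _).eventually (hL i t h0 h1)).and
    (((tendsto_above _).eventually (hR i t h0 h1)).and
    (((tendsto_below _).eventually (hL i t h0 h1)).and
    (((tendsto_below _).eventually (hR i t h0 h1)).and self_mem_nhdsWithin))))).exists
  have hh : 0 < h := hh
  simp only [sub_eq_add_neg (P.point i t).2, side_above, side_point] at e a1 a2 b1 b2
  rcases lt_or_gt_of_ne (P.dir_fst_ne i) with hd | hd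
  · rw [a2 (by nlinarith), b1 (by nlinarith)] at e
    linarith
  · rw [a1 (by nlinarith), b2 (by nlinarith)] at e
    linarith

/-- The winding number at a vertex. -/
lemma LocallyConst.winding_vert {f : ℝ × ℝ → ℝ} (hf : P.LocallyConst f) {cL cR : ℝ}
    (hL : ∀ i, P.OnSide f 1 cL i) (hR : ∀ i, P.OnSide f (-1) cR i)
    (hfar : ∃ M, ∀ z : ℝ × ℝ, z.2 < M → f z = 0) (i : ℕ) :
    (cL - cR) * P.winding (P.vert (i + 1)) =
      (cL + cR) / 2 - (cL - cR) / 2 * P.turnAt i := by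
  have sL := hf.sector one_ne_zero (hL i)
  have sR := hf.sector (neg_ne_zero.2 one_ne_zero) (hR i)
  obtain ⟨h, e, a1, a2, b1, b2, hh⟩ := ((hf.eventually_winding hL hR hfar (P.vert (i + 1))).and
    (((tendsto_above _).eventually sL).and (((tendsto_above _).eventually sR).and
    (((tendsto_below _).eventually sL).and
    (((tendsto_below _).eventually sR).and self_mem_nhdsWithin))))).exists
  have hh : 0 < h := hh
  simp only [sub_eq_add_neg (P.vert (i + 1)).2, Sector, side_above, side_vert, side_vert_succ,
    zero_add, one_mul, neg_mul, mul_neg, neg_neg, Left.neg_pos_iff] at e a1 a2 b1 b2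
  have p1 : ∀ {a : ℝ}, 0 < a → 0 < h * a := fun ha ↦ mul_pos hh ha
  have p2 : ∀ {a : ℝ}, a < 0 → h * a < 0 := fun ha ↦ mul_neg_of_pos_of_neg hh ha
  have hturn : P.turnAt i = if (P.dir i).1 * (P.dir (i + 1)).1 < 0 then Real.sign (P.turnDet i)
    else 0 := rfl
  have hne : (P.dir i).1 * (P.dir (i + 1)).1 < 0 → P.turnDet i ≠ 0 := fun h1 h2 ↦
    (dir_fst_mul_pos h2).not_gt h1
  rcases lt_or_gt_of_ne (P.dir_fst_ne i) with hd | hd <;>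
  rcases lt_or_gt_of_ne (P.dir_fst_ne (i + 1)) with hd' | hd'
  · rw [hturn, if_neg (by nlinarith)]
    have q1 : f ((P.vert (i + 1)).1, (P.vert (i + 1)).2 + h) = cR := a2 (by
      split_ifs <;> simp [p2 hd, p2 hd'])
    have q2 : f ((P.vert (i + 1)).1, (P.vert (i + 1)).2 + -h) = cL := b1 (by
      split_ifs <;> simp [p2 hd, p2 hd'])
    rw [q1, q2] at e
    linarith
  · have hneg : (P.dir i).1 * (P.dir (i + 1)).1 < 0 := mul_neg_of_neg_of_pos hd hd'
    rw [hturn, if_pos hneg]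
    rcases lt_or_gt_of_ne (hne hneg) with hD | hD
    · rw [Real.sign_of_neg hD]
      rw [a1 (by simp [hD.not_gt, p1 hd']), b1 (by simp [hD.not_gt, p2 hd])] at e
      linarith
    · rw [Real.sign_of_pos hD]
      rw [a2 (by simp [hD.not_gt, p2 hd]), b2 (by simp [hD.not_gt, p1 hd'])] at e
      linarith
  · have hneg : (P.dir i).1 * (P.dir (i + 1)).1 < 0 := mul_neg_of_pos_of_neg hd hd'
    rw [hturn, if_pos hneg]
    rcases lt_or_gt_of_ne (hne hneg) with hD | hD
    · rw [Real.sign_of_neg hD]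
      rw [a1 (by simp [hD.not_gt, p1 hd]), b1 (by simp [hD.not_gt, p2 hd'])] at e
      linarith
    · rw [Real.sign_of_pos hD]
      rw [a2 (by simp [hD.not_gt, p2 hd']), b2 (by simp [hD.not_gt, p1 hd])] at e
      linarith
  · rw [hturn, if_neg (by nlinarith)]
    have q1 : f ((P.vert (i + 1)).1, (P.vert (i + 1)).2 + h) = cL := a1 (by
      split_ifs <;> simp [p1 hd, p1 hd'])
    have q2 : f ((P.vert (i + 1)).1, (P.vert (i + 1)).2 + -h) = cR := b2 (by
      split_ifs <;> simp [p1 hd, p1 hd'])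
    rw [q1, q2] at e
    linarith

end GenericPolygon

lemma sign_sub_eq_boole (y : ℤ) (t : ℝ) :
    Real.sign (y - t) = (if ⌊t⌋ < y then 1 else 0) - (if y < ⌈t⌉ then 1 else 0) := by
  simp only [Int.floor_lt, Int.lt_ceil]
  rcases lt_trichotomy (y : ℝ) t with h | h | h
  · rw [Real.sign_of_neg (sub_neg.2 h), if_neg h.not_gt, if_pos h, zero_sub]
  · simp [h]
  · rw [Real.sign_of_pos (sub_pos.2 h), if_pos h, if_neg h.not_gt, sub_zero]

lemma sum_sign_sub {M : ℤ} {t : ℝ} (h1 : -M ≤ t) (h2 : t ≤ M) :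
    ∑ y ∈ Finset.Icc (-M) M, Real.sign ((y : ℝ) - t) = -(⌊t⌋ + ⌈t⌉ : ℝ) := by
  have f1 : -M ≤ ⌊t⌋ := Int.le_floor.2 (by exact_mod_cast h1)
  have f2 : ⌊t⌋ ≤ M := Int.cast_le.1 ((Int.floor_le t).trans h2)
  have f3 : -M ≤ ⌈t⌉ := f1.trans (Int.floor_le_ceil t)
  have f4 : ⌈t⌉ ≤ M := Int.ceil_le.2 h2
  have e1 : (Finset.Icc (-M) M).filter (fun y ↦ ⌊t⌋ < y) = Finset.Ioc ⌊t⌋ M := by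
    ext y
    simp only [Finset.mem_filter, Finset.mem_Icc, Finset.mem_Ioc]
    omega
  have e2 : (Finset.Icc (-M) M).filter (fun y ↦ y < ⌈t⌉) = Finset.Ico (-M) ⌈t⌉ := by
    ext y
    simp only [Finset.mem_filter, Finset.mem_Icc, Finset.mem_Ico]
    omega
  have c1 : ((Finset.Ioc ⌊t⌋ M).card : ℝ) = M - ⌊t⌋ := by
    rw [Int.card_Ioc]
    exact_mod_cast Int.toNat_of_nonneg (by omega)
  have c2 : ((Finset.Ico (-M) ⌈t⌉).card : ℝ) = ⌈t⌉ + M := by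
    rw [Int.card_Ico]
    have : ((⌈t⌉ - -M).toNat : ℤ) = ⌈t⌉ + M := by omega
    exact_mod_cast this
  simp only [sign_sub_eq_boole, Finset.sum_sub_distrib, Finset.sum_boole, e1, e2, c1, c2]
  ring

namespace GenericPolygon

variable {n : ℕ} (P : GenericPolygon n)

/-- The signed area, oriented so that it is the integral of the winding number. -/
noncomputable def signedArea : ℝ :=
  ∑ i ∈ Finset.range n, -((P.vert i).2 + (P.vert (i + 1)).2) * (P.dir i).1 / 2

lemma edge_subset_box {M : ℝ} (hM : ∀ i, |(P.vert i).1| ≤ M ∧ |(P.vert i).2| ≤ M) (i : ℕ) :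
    P.edge i ⊆ Set.Icc (-M, -M) (M, M) := by
  have h : ∀ i, P.vert i ∈ Set.Icc (-M, -M) (M, M) := fun i ↦
    ⟨⟨(abs_le.1 (hM i).1).1, (abs_le.1 (hM i).2).1⟩, ⟨(abs_le.1 (hM i).1).2, (abs_le.1 (hM i).2).2⟩⟩
  exact (convex_Icc _ _).segment_subset (h i) (h (i + 1))

lemma abs_height_le {M : ℝ} (hM : ∀ i, |(P.vert i).1| ≤ M ∧ |(P.vert i).2| ≤ M) {i : ℕ} {x : ℝ}
    (hx : (x - (P.vert i).1) * (x - (P.vert (i + 1)).1) ≤ 0) : |P.height i x| ≤ M := by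
  have h := P.edge_subset_box hM i ((P.mem_edge_iff (z := (x, P.height i x))).2 ⟨rfl, hx⟩)
  exact abs_le.2 ⟨h.1.2, h.2.2⟩

lemma height_add_height {i : ℕ} {x y : ℝ} (h : x + y = (P.vert i).1 + (P.vert (i + 1)).1) :
    P.height i x + P.height i y = (P.vert i).2 + (P.vert (i + 1)).2 := by
  have hd := P.dir_fst_ne i
  have h1 := P.dir_fst i
  have h2 := P.dir_snd i
  have h3 : x - (P.vert i).1 + (y - (P.vert i).1) = (P.dir i).1 := by linarith
  have h4 : (P.dir i).2 / (P.dir i).1 * (P.dir i).1 = (P.dir i).2 := by field_simp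
  simp only [height]
  rw [← h3] at h4
  rw [h3] at h4
  have : (P.dir i).2 / (P.dir i).1 * (x - (P.vert i).1 + (y - (P.vert i).1)) = (P.dir i).2 := by
    rw [h3, h4]
  linarith

lemma span_reflect {i : ℕ} {x y : ℝ} (h : x + y = (P.vert i).1 + (P.vert (i + 1)).1) :
    P.span i x = P.span i y := by
  simp only [span]
  rw [show x - (P.vert i).1 = -(y - (P.vert (i + 1)).1) by linarith,
    show x - (P.vert (i + 1)).1 = -(y - (P.vert i).1) by linarith, Real.sign_neg, Real.sign_neg]
  ring

variable {P} in
lemma sum_crossing {u : ℕ → ℤ × ℤ} (hu : ∀ i, P.vert i = (((u i).1 : ℝ), ((u i).2 : ℝ))) {M : ℤ}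
    (hM : ∀ i, |(u i).1| ≤ M ∧ |(u i).2| ≤ M) (i : ℕ) :
    ∑ x ∈ Finset.Icc (-M) M, ∑ y ∈ Finset.Icc (-M) M, P.crossing i ((x : ℝ), (y : ℝ)) =
      -((P.vert i).2 + (P.vert (i + 1)).2) * (P.dir i).1 / 2 := by
  have hM' : ∀ i, |(P.vert i).1| ≤ (M : ℝ) ∧ |(P.vert i).2| ≤ (M : ℝ) := fun i ↦ by
    rw [hu]
    simp only
    exact_mod_cast hM i
  set H : ℝ → ℝ := fun t ↦ ∑ y ∈ Finset.Icc (-M) M, Real.sign ((y : ℝ) - t) with hH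
  set a := (u i).1 with ha
  set b := (u (i + 1)).1 with hb
  set C : ℤ := (u i).2 + (u (i + 1)).2 with hC
  have va : (P.vert i).1 = a := by rw [hu]
  have vb : (P.vert (i + 1)).1 = b := by rw [hu]
  have vC : (P.vert i).2 + (P.vert (i + 1)).2 = C := by rw [hu, hu, hC]; push_cast; rfl
  have ba := abs_le.1 (hM i).1
  have bb := abs_le.1 (hM (i + 1)).1
  have hsub : Finset.Icc (min a b) (max a b) ⊆ Finset.Icc (-M) M :=
    Finset.Icc_subset_Icc (by omega) (by omega)
  have houtside : ∀ x ∈ Finset.Icc (-M) M, x ∉ Finset.Icc (min a b) (max a b) →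
      P.span i x = 0 := by
    intro x _ hx
    apply P.span_eq_zero
    rw [va, vb]
    have : 0 < (x - a) * (x - b) := by
      rw [Finset.mem_Icc] at hx
      rcases (by omega : (x - a < 0 ∧ x - b < 0) ∨ (0 < x - a ∧ 0 < x - b)) with ⟨h1, h2⟩ | ⟨h1, h2⟩
      · exact mul_pos_of_neg_of_neg h1 h2
      · exact mul_pos h1 h2
    exact_mod_cast this
  have hspan : ∑ x ∈ Finset.Icc (min a b) (max a b), P.span i x = b - a := by
    rw [Finset.sum_subset hsub houtside]
    simp only [span, va, vb]
    have b1 : ∀ c : ℤ, -M ≤ c → c ≤ M →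
        ∑ x ∈ Finset.Icc (-M) M, Real.sign ((x : ℝ) - (c : ℝ)) = -2 * c := fun c h1 h2 ↦ by
      rw [sum_sign_sub (by exact_mod_cast h1) (by exact_mod_cast h2)]
      simp only [Int.floor_intCast, Int.ceil_intCast]
      ring
    rw [← Finset.sum_div, Finset.sum_sub_distrib, b1 a ba.1 ba.2, b1 b bb.1 bb.2]
    ring
  have hreflect : ∑ x ∈ Finset.Icc (min a b) (max a b), P.span i x * H (P.height i x) =
      ∑ x ∈ Finset.Icc (min a b) (max a b), P.span i x * H (C - P.height i x) := by
    have hmem : ∀ x ∈ Finset.Icc (min a b) (max a b),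
        a + b - x ∈ Finset.Icc (min a b) (max a b) := fun x hx ↦ by
      rw [Finset.mem_Icc] at hx ⊢
      omega
    refine Finset.sum_bij' (fun x _ ↦ a + b - x) (fun x _ ↦ a + b - x) hmem hmem
      (fun x _ ↦ by ring) (fun x _ ↦ by ring) fun x _ ↦ ?_
    have hxy : (x : ℝ) + ((a + b - x : ℤ) : ℝ) = (P.vert i).1 + (P.vert (i + 1)).1 := by
      rw [va, vb]
      push_cast
      ring
    rw [P.span_reflect hxy, ← vC, ← P.height_add_height hxy, add_sub_cancel_right]
  have hpair : ∀ x ∈ Finset.Icc (min a b) (max a b),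
      H (P.height i x) + H (C - P.height i x) = -2 * C := by
    intro x hx
    have hneg : ∀ x ∈ Finset.Icc (min a b) (max a b),
        ((x : ℝ) - (P.vert i).1) * (x - (P.vert (i + 1)).1) ≤ 0 := by
      intro x hx
      have : (x - a) * (x - b) ≤ 0 := by
        rw [Finset.mem_Icc] at hx
        rcases (by omega : (x - a ≤ 0 ∧ 0 ≤ x - b) ∨ (0 ≤ x - a ∧ x - b ≤ 0)) with
          ⟨h1, h2⟩ | ⟨h1, h2⟩
        · exact mul_nonpos_of_nonpos_of_nonneg h1 h2
        · exact mul_nonpos_of_nonneg_of_nonpos h1 h2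
      rw [va, vb]
      exact_mod_cast this
    have h1 := abs_le.1 (P.abs_height_le hM' (hneg x hx))
    have h2 : |(C : ℝ) - P.height i x| ≤ M := by
      have hxy : ((a + b - x : ℤ) : ℝ) + (x : ℝ) = (P.vert i).1 + (P.vert (i + 1)).1 := by
        rw [va, vb]
        push_cast
        ring
      rw [← vC, ← P.height_add_height hxy, add_sub_cancel_right]
      refine P.abs_height_le hM' (hneg _ ?_)
      rw [Finset.mem_Icc] at hx ⊢
      omega
    have h2 := abs_le.1 h2
    simp only [hH]
    rw [sum_sign_sub h1.1 h1.2, sum_sign_sub h2.1 h2.2, sub_eq_add_neg (C : ℝ), Int.floor_intCast_add,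
      Int.ceil_intCast_add, Int.floor_neg, Int.ceil_neg]
    push_cast
    ring
  have htot : 2 * ∑ x ∈ Finset.Icc (min a b) (max a b), P.span i x * H (P.height i x) =
      -2 * C * (b - a) := by
    rw [two_mul]
    nth_rewrite 2 [hreflect]
    rw [← Finset.sum_add_distrib, ← hspan, Finset.mul_sum]
    refine Finset.sum_congr rfl fun x hx ↦ ?_
    rw [← mul_add, hpair x hx, mul_comm]
  have hcross : ∀ x : ℤ, ∑ y ∈ Finset.Icc (-M) M, P.crossing i ((x : ℝ), (y : ℝ)) =
      P.span i x * H (P.height i x) / 2 := fun x ↦ by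
    simp only [crossing, hH]
    rw [← Finset.sum_div, Finset.mul_sum]
  rw [Finset.sum_congr rfl fun x _ ↦ hcross x, ← Finset.sum_subset hsub fun x hx hx' ↦ by
    rw [houtside x hx hx']
    ring]
  rw [← Finset.sum_div, vC, dir_fst, va, vb]
  linarith

variable {P} in
/-- The sum of the winding numbers of all lattice points is the signed area. -/
lemma sum_winding {u : ℕ → ℤ × ℤ} (hu : ∀ i, P.vert i = (((u i).1 : ℝ), ((u i).2 : ℝ))) {M : ℤ}
    (hM : ∀ i, |(u i).1| ≤ M ∧ |(u i).2| ≤ M) :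
    ∑ x ∈ Finset.Icc (-M) M, ∑ y ∈ Finset.Icc (-M) M, P.winding ((x : ℝ), (y : ℝ)) =
      P.signedArea := by
  simp only [winding, signedArea, ← sum_crossing hu hM]
  rw [Finset.sum_comm (s := Finset.range n)]
  exact Finset.sum_congr rfl fun x _ ↦ Finset.sum_comm

end GenericPolygon

lemma monotone_sign : Monotone Real.sign := by
  intro a b hab
  rcases lt_trichotomy a 0 with ha | ha | ha
  · rw [Real.sign_of_neg ha]
    rcases Real.sign_apply_eq b with h | h | h <;> rw [h] <;> norm_num
  · rcases hab.lt_or_eq with h | rfl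
    · rw [Real.sign_of_pos (r := b) (by linarith), ha, Real.sign_zero]
      norm_num
    · exact le_rfl
  · rw [Real.sign_of_pos ha, Real.sign_of_pos (ha.trans_le hab)]

lemma intervalIntegrable_sign_sub (t a b : ℝ) :
    IntervalIntegrable (fun y : ℝ ↦ Real.sign (y - t)) volume a b :=
  Monotone.intervalIntegrable fun _ _ h ↦ monotone_sign (sub_le_sub_right h t)

lemma integral_sign_sub {M t : ℝ} (h1 : -M ≤ t) (h2 : t ≤ M) :
    ∫ y in (-M)..M, Real.sign (y - t) = -2 * t := by
  have e := integral_eq_of_hasDerivAt_off_countable (fun y ↦ |y - t|)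
    (fun y ↦ Real.sign (y - t)) (a := -M) (b := M) (Set.countable_singleton t) (by fun_prop)
    (fun y hy ↦ by
      have hy : y - t ≠ 0 := sub_ne_zero.2 hy.2
      rcases lt_or_gt_of_ne hy with h | h
      · rw [Real.sign_of_neg h]
        simpa [Function.comp_def] using
          (hasDerivAt_abs_neg h).comp y ((hasDerivAt_id y).sub_const t)
      · rw [Real.sign_of_pos h]
        simpa [Function.comp_def] using
          (hasDerivAt_abs_pos h).comp y ((hasDerivAt_id y).sub_const t))
    (intervalIntegrable_sign_sub t _ _)
  rw [e, abs_of_nonneg (by linarith), abs_of_nonpos (by linarith)]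
  ring

namespace GenericPolygon

variable {n : ℕ} (P : GenericPolygon n)

lemma integral_height (i : ℕ) : ∫ x in (P.vert i).1..(P.vert (i + 1)).1, P.height i x =
    ((P.vert i).2 + (P.vert (i + 1)).2) * (P.dir i).1 / 2 := by
  set a := (P.vert i).1 with ha
  set b := (P.vert (i + 1)).1 with hb
  have hr := intervalIntegral.integral_comp_sub_left (P.height i) (a := a) (b := b) (a + b)
  rw [add_sub_cancel_right, add_sub_cancel_left] at hr
  have hc := P.continuous_height i
  have hs : ∫ x in a..b, (P.height i x + P.height i (a + b - x)) =
      ∫ x in a..b, ((P.vert i).2 + (P.vert (i + 1)).2) :=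
    intervalIntegral.integral_congr fun x _ ↦ P.height_add_height (by ring)
  rw [intervalIntegral.integral_add (hc.intervalIntegrable _ _)
    (Continuous.intervalIntegrable (by fun_prop) _ _), hr, intervalIntegral.integral_const,
    smul_eq_mul] at hs
  rw [P.dir_fst]
  linarith

lemma span_mul_eq (i : ℕ) : (fun x ↦ P.span i x * P.height i x) =ᵐ[volume]
    (Set.uIoc (P.vert i).1 (P.vert (i + 1)).1).indicator
      (fun x ↦ Real.sign (P.dir i).1 * P.height i x) := by
  have h1 : ∀ a : ℝ, ∀ᵐ x : ℝ, x ≠ a := fun a ↦ Measure.ae_ne volume a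
  filter_upwards [h1 (P.vert i).1, h1 (P.vert (i + 1)).1] with x hxa hxb
  rcases lt_or_gt_of_ne (mul_ne_zero (sub_ne_zero.2 hxa) (sub_ne_zero.2 hxb)) with h | h
  · rw [P.span_eq_sign h, Set.indicator_of_mem]
    rw [Set.mem_uIoc]
    rcases mul_neg_iff.1 h with ⟨h1, h2⟩ | ⟨h1, h2⟩
    · left; constructor <;> linarith
    · right; constructor <;> linarith
  · rw [P.span_eq_zero h, Set.indicator_of_notMem, zero_mul]
    rw [Set.mem_uIoc]
    rintro (⟨h1, h2⟩ | ⟨h1, h2⟩) <;> nlinarith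

lemma integrable_span_mul (i : ℕ) : Integrable fun x ↦ P.span i x * P.height i x := by
  refine Integrable.congr ?_ (P.span_mul_eq i).symm
  rw [integrable_indicator_iff measurableSet_uIoc]
  exact (intervalIntegrable_iff.1
    ((continuous_const.mul (P.continuous_height i)).intervalIntegrable _ _))

lemma integral_span_mul (i : ℕ) : ∫ x, P.span i x * P.height i x =
    ((P.vert i).2 + (P.vert (i + 1)).2) * (P.dir i).1 / 2 := by
  rw [integral_congr_ae (P.span_mul_eq i), integral_indicator measurableSet_uIoc,
    integral_const_mul, ← P.integral_height i, intervalIntegral.intervalIntegral_eq_integral_uIoc,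
    smul_eq_mul]
  have hd := P.dir_fst_ne i
  have hd' := P.dir_fst i
  rcases lt_or_gt_of_ne hd with h | h
  · rw [Real.sign_of_neg h, if_neg (by linarith)]
  · rw [Real.sign_of_pos h, if_pos (by linarith)]

variable {P} in
lemma integral_winding_vertical {M : ℝ} (hM : ∀ i, |(P.vert i).1| ≤ M ∧ |(P.vert i).2| ≤ M)
    (x : ℝ) : ∫ y in (-M)..M, P.winding (x, y) =
      -∑ i ∈ Finset.range n, P.span i x * P.height i x := by
  simp only [winding, crossing]
  rw [intervalIntegral.integral_finsetSum fun i _ ↦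
    ((intervalIntegrable_sign_sub _ _ _).const_mul _).div_const _, ← Finset.sum_neg_distrib]
  refine Finset.sum_congr rfl fun i _ ↦ ?_
  rw [intervalIntegral.integral_div, intervalIntegral.integral_const_mul]
  rcases lt_or_ge 0 ((x - (P.vert i).1) * (x - (P.vert (i + 1)).1)) with h | h
  · rw [P.span_eq_zero h]
    ring
  · have h1 := abs_le.1 (P.abs_height_le hM h)
    rw [integral_sign_sub h1.1 h1.2]
    ring

variable {P} in
/-- The area of a bounded open set whose indicator is a multiple of the winding number. -/
lemma volume_toReal_eq {M : ℝ} (hM : ∀ i, |(P.vert i).1| ≤ M ∧ |(P.vert i).2| ≤ M)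
    {Ω : Set (ℝ × ℝ)} (hopen : IsOpen Ω) (hbounded : Bornology.IsBounded Ω)
    (hΩ : ∀ z ∈ Ω, |z.2| ≤ M) {s : ℝ}
    (hs : ∀ z, z ∉ P.boundary → Ω.indicator 1 z = s * P.winding z) :
    (volume Ω).toReal = s * P.signedArea := by
  have hM0 : 0 ≤ M := (abs_nonneg _).trans (hM 0).1
  have hint : Integrable (Ω.indicator (1 : ℝ × ℝ → ℝ)) (volume.prod volume) := by
    rw [← Measure.volume_eq_prod, integrable_indicator_iff hopen.measurableSet]
    exact integrableOn_const hbounded.measure_lt_top.ne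
  have hslice : ∀ x, ∫ y, Ω.indicator (1 : ℝ × ℝ → ℝ) (x, y) =
      s * -∑ i ∈ Finset.range n, P.span i x * P.height i x := by
    intro x
    rw [← integral_winding_vertical hM, ← intervalIntegral.integral_const_mul,
      ← setIntegral_eq_integral_of_forall_compl_eq_zero (s := Set.Icc (-M) M),
      integral_Icc_eq_integral_Ioc, ← intervalIntegral.integral_of_le (by linarith)]
    · have hae : ∀ᵐ y : ℝ, ∀ i ∈ Finset.range n, y ≠ P.height i x :=
        (Filter.eventually_all_finset _).2 fun i _ ↦ Measure.ae_ne volume _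
      refine intervalIntegral.integral_congr_ae ?_
      filter_upwards [hae] with y hy _
      refine hs _ ?_
      rintro ⟨i, hi⟩
      rw [← P.edge_mod, mem_edge_iff] at hi
      exact hy _ (Finset.mem_range.2 (Nat.mod_lt _ P.n_pos)) hi.1
    · intro y hy
      refine Set.indicator_of_notMem (fun h ↦ hy ?_) _
      exact abs_le.1 (hΩ _ h)
  have := integral_indicator_one (μ := (volume : Measure (ℝ × ℝ))) hopen.measurableSet
  rw [Measure.real] at this
  rw [← this, Measure.volume_eq_prod, integral_prod _ hint]
  simp only [hslice]
  rw [integral_const_mul, integral_neg, integral_finsetSum _ fun i _ ↦ P.integrable_span_mul i]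
  simp only [integral_span_mul, signedArea]
  rw [← Finset.sum_neg_distrib]
  congr 1
  exact Finset.sum_congr rfl fun i _ ↦ by ring

end GenericPolygon

namespace GenericPolygon

variable {n : ℕ} {P : GenericPolygon n}

lemma vert_eq_iff {i j : ℕ} (hi : i < n) (hj : j < n) :
    P.vert (i + 1) = P.vert (j + 1) ↔ i = j := by
  refine ⟨fun h ↦ ?_, fun h ↦ h ▸ rfl⟩
  by_contra hne
  rcases lt_or_gt_of_ne hne with h' | h'
  · exact P.fst_ne (i + 1) (j + 1) (by omega) (by omega) (congrArg Prod.fst h)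
  · exact P.fst_ne (j + 1) (i + 1) (by omega) (by omega) (congrArg Prod.fst h.symm)

lemma vert_mem_edge (i : ℕ) : P.vert i ∈ P.edge i := left_mem_segment _ _ _

lemma exists_eq_vert (i : ℕ) : ∃ j < n, P.vert i = P.vert (j + 1) := by
  have hn := P.n_pos
  refine ⟨(i + (n - 1)) % n, Nat.mod_lt _ hn, ?_⟩
  have hmod : ∀ i, P.vert (i % n) = P.vert i := Function.Periodic.map_mod_nat P.periodic
  rw [← hmod ((i + (n - 1)) % n + 1), Nat.mod_add_mod, hmod,
    show i + (n - 1) + 1 = i + n by omega, P.periodic]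

lemma locallyConst_indicator {Ω : Set (ℝ × ℝ)} (hopen : IsOpen Ω) (hfr : frontier Ω = P.boundary) :
    P.LocallyConst (Ω.indicator 1) := by
  have key : ∀ K : Set (ℝ × ℝ), Convex ℝ K → (∀ z ∈ K, z ∉ P.boundary) →
      ∀ z ∈ K, ∀ w ∈ K, z ∈ Ω → w ∈ Ω := by
    intro K hK hKb z hz w hw hzΩ
    by_contra hwΩ
    have hcl : ∀ p ∈ K, p ∉ Ω → p ∉ closure Ω := fun p hp hpΩ h ↦
      hKb p hp (hfr ▸ hopen.frontier_eq ▸ ⟨h, hpΩ⟩)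
    obtain ⟨p, -, hp, hp'⟩ := hK.isPreconnected Ω (closure Ω)ᶜ hopen isClosed_closure.isOpen_compl
      (fun p hp ↦ or_iff_not_imp_left.2 (hcl p hp)) ⟨z, hz, hzΩ⟩ ⟨w, hw, hcl w hw hwΩ⟩
    exact hp' (subset_closure hp)
  intro K hK hKb z hz w hw
  by_cases h : z ∈ Ω
  · rw [Set.indicator_of_mem h, Set.indicator_of_mem (key K hK hKb z hz w hw h), Pi.one_apply,
      Pi.one_apply]
  · rw [Set.indicator_of_notMem h,
      Set.indicator_of_notMem fun hw' ↦ h (key K hK hKb w hw z hz hw')]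

lemma OnSide.eq_zero_or_eq_one {Ω : Set (ℝ × ℝ)} {ε c : ℝ} (hε : ε ≠ 0)
    (h : P.OnSide (Ω.indicator 1) ε c 0) : c = 0 ∨ c = 1 := by
  obtain ⟨z, h1, h2⟩ := ((P.frequently_side_pos hε (P.side_point 0 (1 / 2))).and_eventually
    (h (1 / 2) (by norm_num) (by norm_num))).exists
  rw [← h2 h1]
  by_cases hz : z ∈ Ω <;> simp [hz]

lemma notMem_of_mem_boundary {Ω : Set (ℝ × ℝ)} (hopen : IsOpen Ω)
    (hfr : frontier Ω = P.boundary) {z : ℝ × ℝ} (hz : z ∈ Ω) : z ∉ P.boundary := fun h ↦ by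
  have : z ∈ Ω ∩ frontier Ω := ⟨hz, hfr ▸ h⟩
  rwa [hopen.inter_frontier_eq] at this

lemma winding_eq_zero {z : ℝ × ℝ} (hz : ∀ i, z.1 < (P.vert i).1) : P.winding z = 0 :=
  Finset.sum_eq_zero fun i _ ↦ by
    rw [crossing, P.span_eq_zero (mul_pos_of_neg_of_neg (sub_neg.2 (hz _)) (sub_neg.2 (hz _)))]
    ring

variable (P) in
/-- The correction terms which vertices contribute to the winding number. -/
noncomputable def turnWeight (z : ℝ × ℝ) : ℝ :=
  open Classical in ∑ i ∈ Finset.range n, if z = P.vert (i + 1) then P.turnAt i else 0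

lemma turnWeight_vert {i : ℕ} (hi : i < n) : P.turnWeight (P.vert (i + 1)) = P.turnAt i := by
  rw [turnWeight, Finset.sum_eq_single_of_mem i (Finset.mem_range.2 hi), if_pos rfl]
  intro j hj hji
  rw [if_neg]
  rw [vert_eq_iff hi (Finset.mem_range.1 hj)]
  exact hji.symm

lemma turnWeight_eq_zero {z : ℝ × ℝ} (hz : ∀ i < n, z ≠ P.vert (i + 1)) : P.turnWeight z = 0 :=
  Finset.sum_eq_zero fun i hi ↦ if_neg (hz i (Finset.mem_range.1 hi))

/-- The data of a bounded open set with the given polygon as frontier: its indicator function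
jumps by `s = ±1` across the polygon. -/
lemma exists_jump {Ω : Set (ℝ × ℝ)} (hopen : IsOpen Ω) (hne : Ω.Nonempty)
    (hbounded : Bornology.IsBounded Ω) (hfr : frontier Ω = P.boundary) :
    ∃ s : ℝ, (∀ z, z ∉ P.boundary → Ω.indicator 1 z = s * P.winding z) ∧
      (∀ z, s * P.winding z = Ω.indicator 1 z + P.boundary.indicator 1 z / 2 -
        s / 2 * P.turnWeight z) ∧
      ∀ z, ∀ᶠ h in nhdsWithin (0 : ℝ) (Set.Ioi 0), Ω.indicator (1 : ℝ × ℝ → ℝ) (z.1, z.2 + h) +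
        Ω.indicator (1 : ℝ × ℝ → ℝ) (z.1, z.2 - h) = 2 * (s * P.winding z) := by
  have hf := locallyConst_indicator hopen hfr
  obtain ⟨cL, hL⟩ := hf.exists_onSide one_ne_zero
  obtain ⟨cR, hR⟩ := hf.exists_onSide (neg_ne_zero.2 one_ne_zero)
  have hfar : ∃ M, ∀ z : ℝ × ℝ, z.2 < M → Ω.indicator (1 : ℝ × ℝ → ℝ) z = 0 := by
    obtain ⟨R, hR⟩ := hbounded.subset_closedBall 0
    refine ⟨-R, fun z hz ↦ Set.indicator_of_notMem (fun h ↦ ?_) _⟩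
    have h1 := (norm_snd_le z).trans (mem_closedBall_zero_iff.1 (hR h))
    rw [Real.norm_eq_abs] at h1
    linarith [(abs_le.1 h1).1]
  have hw := fun z hz ↦ hf.eq_winding hL hR hfar (z := z) hz
  have hs : cL - cR ≠ 0 := by
    intro h0
    obtain ⟨z, hz⟩ := hne
    have := hw z (notMem_of_mem_boundary hopen hfr hz)
    rw [h0, zero_mul, Set.indicator_of_mem hz] at this
    exact one_ne_zero this
  have hsum : cL + cR = 1 := by
    rcases (hL 0).eq_zero_or_eq_one one_ne_zero with rfl | rfl <;>
    rcases (hR 0).eq_zero_or_eq_one (neg_ne_zero.2 one_ne_zero) with rfl | rfl <;>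
    first | exact absurd (sub_self _) hs | norm_num
  refine ⟨cL - cR, hw, fun z ↦ ?_, hf.eventually_winding hL hR hfar⟩
  by_cases hv : ∃ i < n, z = P.vert (i + 1)
  · obtain ⟨i, hi, rfl⟩ := hv
    have hb : P.vert (i + 1) ∈ P.boundary := ⟨i + 1, vert_mem_edge _⟩
    rw [hf.winding_vert hL hR hfar, turnWeight_vert hi, Set.indicator_of_mem hb,
      Set.indicator_of_notMem fun h ↦ notMem_of_mem_boundary hopen hfr h hb, hsum, Pi.one_apply]
    ring
  · push Not at hv
    rw [turnWeight_eq_zero hv]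
    by_cases hb : z ∈ P.boundary
    · rw [Set.indicator_of_mem hb,
        Set.indicator_of_notMem fun h ↦ notMem_of_mem_boundary hopen hfr h hb]
      obtain ⟨i, hi⟩ := hb
      obtain ⟨t, h0, h1, rfl⟩ := P.mem_edge.1 hi
      have hne : ∀ j, P.point i t ≠ P.vert j := fun j hj ↦ by
        obtain ⟨k, hk, e⟩ := P.exists_eq_vert j
        exact hv k hk (hj.trans e)
      have h0 : 0 < t := h0.lt_of_ne (by
        rintro rfl
        exact hne i (by simp [point]))
      have h1 : t < 1 := h1.lt_of_ne (by
        rintro rfl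
        exact hne (i + 1) (P.point_one i))
      rw [hf.winding_point hL hR hfar i h0 h1, hsum, Pi.one_apply]
      ring
    · rw [← hw z hb, Set.indicator_of_notMem hb]
      ring

lemma sum_box_indicator {Ω : Set (ℝ × ℝ)} {M : ℤ}
    (hM : ∀ z ∈ Ω, |z.1| ≤ (M : ℝ) ∧ |z.2| ≤ (M : ℝ)) :
    ∑ x ∈ Finset.Icc (-M) M, ∑ y ∈ Finset.Icc (-M) M,
      Ω.indicator (1 : ℝ × ℝ → ℝ) ((x : ℝ), (y : ℝ)) =
      Set.ncard {p : ℤ × ℤ | ((p.1 : ℝ), (p.2 : ℝ)) ∈ Ω} := by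
  classical
  have e : {p : ℤ × ℤ | ((p.1 : ℝ), (p.2 : ℝ)) ∈ Ω} =
      ((Finset.Icc (-M) M ×ˢ Finset.Icc (-M) M).filter
        (fun p : ℤ × ℤ ↦ ((p.1 : ℝ), (p.2 : ℝ)) ∈ Ω) : Finset (ℤ × ℤ)) := by
    ext p
    simp only [Set.mem_ofPred_eq, Finset.coe_filter, Finset.mem_product, Finset.mem_Icc]
    refine ⟨fun h ↦ ⟨?_, h⟩, fun h ↦ h.2⟩
    obtain ⟨h1, h2⟩ := hM _ h
    simp only at h1 h2
    have h1 : |p.1| ≤ M := by exact_mod_cast h1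
    have h2 : |p.2| ≤ M := by exact_mod_cast h2
    exact ⟨abs_le.1 h1, abs_le.1 h2⟩
  rw [e, Set.ncard_coe_finset, ← Finset.sum_product', ← Finset.sum_boole]
  exact Finset.sum_congr rfl fun p _ ↦ by simp [Set.indicator_apply]

lemma sum_box_turnWeight {u : ℕ → ℤ × ℤ} (hu : ∀ i, P.vert i = (((u i).1 : ℝ), ((u i).2 : ℝ)))
    {M : ℤ} (hM : ∀ i, |(u i).1| ≤ M ∧ |(u i).2| ≤ M) :
    ∑ x ∈ Finset.Icc (-M) M, ∑ y ∈ Finset.Icc (-M) M, P.turnWeight ((x : ℝ), (y : ℝ)) =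
      ∑ i ∈ Finset.range n, P.turnAt i := by
  classical
  rw [← Finset.sum_product']
  simp only [turnWeight]
  rw [Finset.sum_comm]
  refine Finset.sum_congr rfl fun i _ ↦ ?_
  have hiff : ∀ p : ℤ × ℤ, ((p.1 : ℝ), (p.2 : ℝ)) = P.vert (i + 1) ↔ p = u (i + 1) := fun p ↦ by
    rw [hu, Prod.ext_iff, Prod.ext_iff]
    simp only [Int.cast_inj]
  simp only [hiff]
  rw [Finset.sum_ite_eq', if_pos]
  rw [Finset.mem_product, Finset.mem_Icc, Finset.mem_Icc]
  exact ⟨abs_le.1 (hM _).1, abs_le.1 (hM _).2⟩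

/-- Pick's theorem for polygons whose vertices have distinct abscissae. -/
theorem pick {u : ℕ → ℤ × ℤ} (hu : ∀ i, P.vert i = (((u i).1 : ℝ), ((u i).2 : ℝ)))
    (hmin : ∀ i, 0 < i → i < n → (P.vert 0).1 < (P.vert i).1) {Ω : Set (ℝ × ℝ)}
    (hopen : IsOpen Ω) (hne : Ω.Nonempty) (hbounded : Bornology.IsBounded Ω)
    (hfr : frontier Ω = P.boundary) :
    (volume Ω).toReal =
      (Set.ncard {p : ℤ × ℤ | ((p.1 : ℝ), (p.2 : ℝ)) ∈ Ω} : ℝ)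
      + (Set.ncard {p : ℤ × ℤ | ((p.1 : ℝ), (p.2 : ℝ)) ∈ P.boundary} : ℝ) / 2 - 1 := by
  obtain ⟨s, hs, hsW, hmean⟩ := exists_jump hopen hne hbounded hfr
  obtain ⟨M, hM⟩ : ∃ M : ℤ, ∀ z ∈ closure Ω, |z.1| ≤ (M : ℝ) ∧ |z.2| ≤ (M : ℝ) := by
    obtain ⟨R, hR⟩ := hbounded.closure.subset_closedBall 0
    refine ⟨⌈R⌉, fun z hz ↦ ?_⟩
    have h := (mem_closedBall_zero_iff.1 (hR hz)).trans (Int.le_ceil R)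
    exact ⟨(norm_fst_le z).trans h, (norm_snd_le z).trans h⟩
  have hMb : ∀ z ∈ P.boundary, |z.1| ≤ (M : ℝ) ∧ |z.2| ≤ (M : ℝ) := fun z hz ↦
    hM z (frontier_subset_closure (hfr ▸ hz))
  have hMΩ : ∀ z ∈ Ω, |z.1| ≤ (M : ℝ) ∧ |z.2| ≤ (M : ℝ) := fun z hz ↦ hM z (subset_closure hz)
  have hMv : ∀ i, |(P.vert i).1| ≤ (M : ℝ) ∧ |(P.vert i).2| ≤ (M : ℝ) := fun i ↦
    hMb _ ⟨i, vert_mem_edge i⟩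
  have hMu : ∀ i, |(u i).1| ≤ M ∧ |(u i).2| ≤ M := fun i ↦ by
    have := hMv i
    rw [hu] at this
    simp only at this
    exact_mod_cast this
  have hmod : ∀ i, P.vert (i % n) = P.vert i := Function.Periodic.map_mod_nat P.periodic
  have hmin' : ∀ i, (P.vert 0).1 ≤ (P.vert i).1 := fun i ↦ by
    rw [← hmod i]
    rcases Nat.eq_zero_or_pos (i % n) with h | h
    · rw [h]
    · exact (hmin _ h (Nat.mod_lt _ P.n_pos)).le
  have hleft : ∀ y, ((P.vert 0).1, y) ∉ Ω := by
    intro y hy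
    have hc : Filter.Tendsto (fun h : ℝ ↦ ((P.vert 0).1 - h, y)) (nhdsWithin 0 (Set.Ioi 0))
        (nhds ((P.vert 0).1, y)) := by
      have : ContinuousAt (fun h : ℝ ↦ ((P.vert 0).1 - h, y)) 0 := by fun_prop
      simpa using this.tendsto.mono_left nhdsWithin_le_nhds
    obtain ⟨h, h1, h2⟩ := ((hc.eventually (hopen.mem_nhds hy)).and self_mem_nhdsWithin).exists
    have h2 : 0 < h := h2
    have h3 := hs _ (notMem_of_mem_boundary hopen hfr h1)
    rw [Set.indicator_of_mem h1, winding_eq_zero (fun i ↦ by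
      have := hmin' i
      simp only
      linarith), mul_zero] at h3
    exact one_ne_zero h3
  have hturn : s * P.turnAt (n - 1) = 1 := by
    have hn := P.n_pos
    obtain ⟨h, hh⟩ := (hmean (P.vert 0)).exists
    rw [Set.indicator_of_notMem (hleft _), Set.indicator_of_notMem (hleft _)] at hh
    have h0 : P.vert 0 = P.vert (n - 1 + 1) := by
      rw [Nat.sub_add_cancel hn]
      simpa using (P.periodic 0).symm
    have hb : P.vert (n - 1 + 1) ∈ P.boundary := ⟨_, vert_mem_edge _⟩
    rw [h0, hsW, turnWeight_vert (by omega), Set.indicator_of_mem hb,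
      Set.indicator_of_notMem (fun h ↦ notMem_of_mem_boundary hopen hfr h hb), Pi.one_apply] at hh
    linarith
  rw [volume_toReal_eq hMv hopen hbounded (fun z hz ↦ (hMΩ z hz).2) hs, ← sum_winding hu hMu]
  simp only [Finset.mul_sum, hsW]
  simp only [Finset.sum_sub_distrib, Finset.sum_add_distrib, ← Finset.sum_div, ← Finset.mul_sum]
  rw [sum_box_indicator hMΩ, sum_box_indicator hMb, sum_box_turnWeight hu hMu, P.sum_turnAt hmin]
  linarith

end GenericPolygon

namespace GenericPolygon

/-- A closed simple polygon whose vertices have distinct abscissae, indexed from vertex `k`. -/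
lemma exists_vert_eq {n : ℕ} (hn : 3 ≤ n) {w : ℕ → ℝ × ℝ} (hclosed : w n = w 0)
    (hinj : ∀ i < n, ∀ j < n, (w i).1 = (w j).1 → i = j)
    (hsimple : ∀ i j, i < j → j < n →
      (j = i + 1 → segment ℝ (w i) (w (i + 1)) ∩ segment ℝ (w j) (w (j + 1)) = {w j}) ∧
      (i = 0 ∧ j = n - 1 →
        segment ℝ (w i) (w (i + 1)) ∩ segment ℝ (w j) (w (j + 1)) = {w 0}) ∧
      (j ≠ i + 1 → ¬(i = 0 ∧ j = n - 1) →
        segment ℝ (w i) (w (i + 1)) ∩ segment ℝ (w j) (w (j + 1)) = ∅)) (k : ℕ) :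
    ∃ P : GenericPolygon n, (∀ i, P.vert i = w ((i + k) % n)) ∧
      P.boundary = ⋃ i ∈ Finset.range n, segment ℝ (w i) (w (i + 1)) := by
  have hpos : 0 < n := by omega
  have hlt : ∀ i, i % n < n := fun i ↦ Nat.mod_lt i hpos
  have hmod : ∀ i d, d < n → (i + d) % n = i % n + d ∨ (i + d) % n + n = i % n + d := by
    intro i d hd
    have := hlt i
    rw [Nat.add_mod_eq_ite, Nat.mod_eq_of_lt hd]
    split_ifs <;> omega
  have hsucc : ∀ i, w ((i + 1) % n) = w (i % n + 1) := by
    intro i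
    rcases hmod i 1 (by omega) with h | h
    · rw [h]
    · have := hlt i
      have := hlt (i + 1)
      rw [show i % n + 1 = n by omega, show (i + 1) % n = 0 by omega, hclosed]
  have hseg : ∀ i, segment ℝ (w ((i + k) % n)) (w ((i + 1 + k) % n)) =
      segment ℝ (w ((i + k) % n)) (w ((i + k) % n + 1)) := fun i ↦ by
    rw [show i + 1 + k = i + k + 1 by omega, hsucc]
  refine ⟨⟨fun i ↦ w ((i + k) % n), hn, ?_, ?_, ?_, ?_⟩, fun _ ↦ rfl, ?_⟩
  · intro i
    rw [show i + n + k = i + k + n by omega, Nat.add_mod_right]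
  · intro i j hij hj h
    have h1 := hinj _ (hlt _) _ (hlt _) h
    have := hlt (i + k)
    rcases hmod (i + k) (j - i) (by omega) with h2 | h2 <;>
    rw [show i + k + (j - i) = j + k by omega] at h2 <;> omega
  · intro i z h1 h2
    rw [hseg] at h1 h2
    have l1 := hlt (i + k)
    have l2 := hlt (i + 1 + k)
    rcases hmod (i + k) 1 (by omega) with h3 | h3 <;>
    rw [show i + k + 1 = i + 1 + k by omega] at h3
    · have := (hsimple ((i + k) % n) ((i + 1 + k) % n) (by omega) l2).1 h3
      exact this.subset ⟨h1, h2⟩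
    · have e1 : (i + 1 + k) % n = 0 := by omega
      have e2 : (i + k) % n = n - 1 := by omega
      have := (hsimple ((i + 1 + k) % n) ((i + k) % n) (by omega) l1).2.1 ⟨e1, e2⟩
      have := this.subset ⟨h2, h1⟩
      rw [e1]
      exact this
  · intro i j hij hj z h1 h2
    rw [hseg] at h1 h2
    have l1 := hlt (i + k)
    have l2 := hlt (j + k)
    rcases hmod (i + k) (j - i) (by omega) with h3 | h3 <;>
    rw [show i + k + (j - i) = j + k by omega] at h3
    · have := (hsimple ((i + k) % n) ((j + k) % n) (by omega) l2).2.2 (by omega) (by omega)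
      exact this.subset ⟨h1, h2⟩
    · have := (hsimple ((j + k) % n) ((i + k) % n) (by omega) l1).2.2 (by omega) (by omega)
      exact this.subset ⟨h2, h1⟩
  · ext z
    simp only [boundary, edge, Set.mem_ofPred_eq, Set.mem_iUnion, Finset.mem_range, hseg,
      exists_prop]
    constructor
    · rintro ⟨i, hi⟩
      exact ⟨_, hlt _, hi⟩
    · rintro ⟨i, hi, hz⟩
      refine ⟨i + n * k - k, ?_⟩
      have : k ≤ n * k := Nat.le_mul_of_pos_left k hpos
      rw [show i + n * k - k + k = i + n * k by omega, Nat.add_mul_mod_self_left,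
        Nat.mod_eq_of_lt hi]
      exact hz

end GenericPolygon

/-- The horizontal shear `(x, y) ↦ (x + c * y, y)`. -/
noncomputable def shear (c : ℝ) : (ℝ × ℝ) ≃L[ℝ] (ℝ × ℝ) :=
  LinearEquiv.toContinuousLinearEquiv
    { toFun := fun z ↦ (z.1 + c * z.2, z.2)
      invFun := fun z ↦ (z.1 - c * z.2, z.2)
      map_add' := fun z w ↦ by ext <;> (simp; try ring)
      map_smul' := fun a z ↦ by ext <;> (simp; try ring)
      left_inv := fun z ↦ by simp
      right_inv := fun z ↦ by simp }

lemma shear_apply (c : ℝ) (z : ℝ × ℝ) : shear c z = (z.1 + c * z.2, z.2) := rfl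

lemma volume_shear_image (c : ℝ) (s : Set (ℝ × ℝ)) : volume (shear c '' s) = volume s := by
  have hdet : LinearMap.det (shear c : (ℝ × ℝ) →ₗ[ℝ] (ℝ × ℝ)) = 1 := by
    rw [← LinearMap.det_toMatrix (Module.Basis.finTwoProd ℝ), Matrix.det_fin_two]
    simp [LinearMap.toMatrix_apply, shear_apply]
  have := Measure.addHaar_image_linearMap volume (shear c : (ℝ × ℝ) →ₗ[ℝ] (ℝ × ℝ)) s
  rw [hdet] at this
  simpa using this

lemma ncard_shear_image (c : ℤ) (s : Set (ℝ × ℝ)) :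
    Set.ncard {p : ℤ × ℤ | ((p.1 : ℝ), (p.2 : ℝ)) ∈ shear c '' s} =
      Set.ncard {p : ℤ × ℤ | ((p.1 : ℝ), (p.2 : ℝ)) ∈ s} := by
  have hcast : ∀ p : ℤ × ℤ, shear c ((p.1 : ℝ), (p.2 : ℝ)) =
      (((p.1 + c * p.2 : ℤ) : ℝ), (p.2 : ℝ)) := fun p ↦ by
    rw [shear_apply]
    push_cast
    rfl
  have himage : {p : ℤ × ℤ | ((p.1 : ℝ), (p.2 : ℝ)) ∈ shear c '' s} =
      (fun p : ℤ × ℤ ↦ (p.1 + c * p.2, p.2)) '' {p : ℤ × ℤ | ((p.1 : ℝ), (p.2 : ℝ)) ∈ s} := by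
    ext p
    simp only [Set.mem_ofPred_eq]
    constructor
    · intro h
      refine ⟨(p.1 - c * p.2, p.2), ?_, by simp⟩
      have e := hcast (p.1 - c * p.2, p.2)
      simp only [sub_add_cancel] at e
      rw [← e, (shear c).injective.mem_set_image] at h
      exact h
    · rintro ⟨q, hq, rfl⟩
      exact ⟨_, hq, hcast q⟩
  rw [himage, Set.ncard_image_of_injective]
  intro p q h
  simp only [Prod.mk.injEq] at h
  ext
  · have := h.1
    rw [h.2] at this
    linarith
  · exact h.2

/-- Some shear makes the abscissae of finitely many lattice points distinct. -/
lemma exists_shear_injective {n : ℕ} {v : ℕ → ℤ × ℤ}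
    (hinj : ∀ i < n, ∀ j < n, v i = v j → i = j) :
    ∃ c : ℤ, ∀ i < n, ∀ j < n, (v i).1 + c * (v i).2 = (v j).1 + c * (v j).2 → i = j := by
  set S := ∑ i ∈ Finset.range n, |(v i).1| with hS
  have hle : ∀ i < n, |(v i).1| ≤ S := fun i hi ↦
    Finset.single_le_sum (f := fun i ↦ |(v i).1|) (fun _ _ ↦ abs_nonneg _) (Finset.mem_range.2 hi)
  refine ⟨2 * S + 1, fun i hi j hj h ↦ hinj i hi j hj ?_⟩
  have h1 := abs_le.1 (hle i hi)
  have h2 := abs_le.1 (hle j hj)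
  have h3 : (2 * S + 1) * ((v j).2 - (v i).2) = (v i).1 - (v j).1 := by linarith
  have hS0 : 0 ≤ S := (abs_nonneg _).trans (hle i hi)
  have h4 : (v j).2 - (v i).2 = 0 := by
    rcases lt_trichotomy ((v j).2 - (v i).2) 0 with h | h | h
    · nlinarith
    · exact h
    · nlinarith
  rw [h4, mul_zero] at h3
  ext <;> omega

/-- **Pick's theorem.** For a simple polygon with vertices `v 0, …, v (n−1)` in
`ℤ²` (edges meeting only at shared vertices), and `Ω` the enclosed region (a
bounded connected open set whose frontier is the polygonal boundary), the area
of `Ω` equals `I + B/2 − 1`, where `I` is the number of lattice points in `Ω`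
and `B` the number of lattice points on the boundary. -/
theorem pick_theorem (n : ℕ) (hn : 3 ≤ n) (v : ℕ → ℤ × ℤ)
    (hclosed : v n = v 0)
    (hinj : ∀ i < n, ∀ j < n, v i = v j → i = j)
    (V : ℕ → ℝ × ℝ) (hV : ∀ i, V i = (((v i).1 : ℝ), ((v i).2 : ℝ)))
    (bdry : Set (ℝ × ℝ))
    (hbdry : bdry = ⋃ i ∈ Finset.range n, segment ℝ (V i) (V (i + 1)))
    (hsimple : ∀ i j, i < j → j < n →
      (j = i + 1 → segment ℝ (V i) (V (i + 1)) ∩ segment ℝ (V j) (V (j + 1)) = {V j}) ∧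
      (i = 0 ∧ j = n - 1 →
        segment ℝ (V i) (V (i + 1)) ∩ segment ℝ (V j) (V (j + 1)) = {V 0}) ∧
      (j ≠ i + 1 → ¬(i = 0 ∧ j = n - 1) →
        segment ℝ (V i) (V (i + 1)) ∩ segment ℝ (V j) (V (j + 1)) = ∅))
    (Ω : Set (ℝ × ℝ)) (hopen : IsOpen Ω) (hconn : IsConnected Ω)
    (hbounded : Bornology.IsBounded Ω) (hfr : frontier Ω = bdry) :
    (volume Ω).toReal =
      (Set.ncard {p : ℤ × ℤ | ((p.1 : ℝ), (p.2 : ℝ)) ∈ Ω} : ℝ)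
      + (Set.ncard {p : ℤ × ℤ | ((p.1 : ℝ), (p.2 : ℝ)) ∈ bdry} : ℝ) / 2 - 1 := by
  obtain ⟨c, hc⟩ := exists_shear_injective hinj
  set T := shear c with hT
  set x : ℕ → ℤ := fun i ↦ (v i).1 + c * (v i).2 with hx
  have hTV : ∀ i, T (V i) = ((x i : ℝ), ((v i).2 : ℝ)) := fun i ↦ by
    rw [hT, hV, shear_apply]
    simp only [hx]
    push_cast
    rfl
  obtain ⟨k, hk, hmin⟩ := Finset.exists_min_image (Finset.range n) x
    ⟨0, Finset.mem_range.2 (by omega)⟩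
  have hseg : ∀ i, segment ℝ (T (V i)) (T (V (i + 1))) = T '' segment ℝ (V i) (V (i + 1)) :=
    fun i ↦ (image_segment ℝ (T : (ℝ × ℝ) →ₗ[ℝ] (ℝ × ℝ)).toAffineMap _ _).symm
  obtain ⟨P, hvert, hboundary⟩ := GenericPolygon.exists_vert_eq hn (w := fun i ↦ T (V i))
    (by simp only [hV, hclosed])
    (fun i hi j hj h ↦ hc i hi j hj (by
      simp only [hTV] at h
      exact_mod_cast h))
    (fun i j hij hj ↦ by
      obtain ⟨h1, h2, h3⟩ := hsimple i j hij hj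
      simp only [hseg, ← Set.image_inter T.injective]
      refine ⟨fun h ↦ ?_, fun h ↦ ?_, fun h h' ↦ ?_⟩
      · rw [h1 h, Set.image_singleton]
      · rw [h2 h, Set.image_singleton]
      · rw [h3 h h', Set.image_empty]) k
  have hb : P.boundary = T '' bdry := by
    rw [hboundary, hbdry]
    simp only [hseg, Set.image_iUnion]
  have hfrT : frontier (T '' Ω) = P.boundary := by
    rw [hb, ← hfr]
    exact (T.toHomeomorph.image_frontier Ω).symm
  have hleft : ∀ i, 0 < i → i < n → (P.vert 0).1 < (P.vert i).1 := by
    intro i h0 hi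
    refine lt_of_le_of_ne ?_ (P.fst_ne 0 i h0 (by omega))
    rw [hvert, hvert, zero_add, Nat.mod_eq_of_lt (Finset.mem_range.1 hk)]
    simp only [hTV]
    exact_mod_cast hmin _ (Finset.mem_range.2 (Nat.mod_lt _ (by omega)))
  have := GenericPolygon.pick (u := fun i ↦ (x ((i + k) % n), (v ((i + k) % n)).2))
    (fun i ↦ by rw [hvert, hTV]) hleft (Ω := T '' Ω)
    (T.toHomeomorph.isOpenMap _ hopen)
    (hconn.nonempty.image T) (T.lipschitz.isBounded_image hbounded) hfrT
  rwa [hb, hT, volume_shear_image, ncard_shear_image, ncard_shear_image] at this
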